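/- arXiv:2206.11852 — 2 statements merged into one kernel-verified Lean document; each statement's English description precedes it below -/
import Mathlib

section
/- Genuine multipartite nonlocality is intrinsic to quantum networks: let G be a connected graph on n ≥ 2 vertices and, for each edge e = {i,j} of G, let |ψ_e⟩ be an entangled (non-product) pure state on ℂ^{d_e}⊗ℂ^{d'_e}, with one tensor factor held by party i and the other by party j. Then the n-partite network state ⊗_e |ψ_e⟩⟨ψ_e|, where each party's system comprises the tensor factors of all edges incident to it, is GMNL: there exist POVMs with finitely many inputs and outputs for each party, acting on that party's full system, whose resulting correlation box is not bilocal. -/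
open Matrix Finset
open scoped ComplexOrder

attribute [local instance] Classical.propDecidable

noncomputable section

/-- The rank-one matrix `|v⟩⟨v|` associated to a vector `v`. -/
def vecProj {D : Type*} [Fintype D] (v : D → ℂ) : Matrix D D ℂ :=
  Matrix.of fun i j => v i * star (v j)

/-- `v` is a unit vector. -/
def UnitVec {D : Type*} [Fintype D] (v : D → ℂ) : Prop :=
  ∑ i, star (v i) * v i = 1

/-- A quantum state: positive semidefinite matrix of trace one. -/
def IsState {D : Type*} [Fintype D] [DecidableEq D] (ρ : Matrix D D ℂ) : Prop :=
  ρ.PosSemidef ∧ ρ.trace = 1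

/-- An `ι`-partite box: nonnegative entries summing to one over outputs for each input. -/
def IsBoxN {ι : Type*} [Fintype ι] [DecidableEq ι] {X A : ι → Type*}
    [∀ i, Fintype (X i)] [∀ i, Fintype (A i)]
    (P : (∀ i, X i) → (∀ i, A i) → ℝ) : Prop :=
  (∀ x a, 0 ≤ P x a) ∧ ∀ x, ∑ a, P x a = 1

/-- A box is nonsignalling if the marginal distribution of the outputs of any subset `T`
of parties depends only on the inputs of the parties in `T`. -/
def NonSignalling {ι : Type*} [Fintype ι] [DecidableEq ι] {X A : ι → Type*}
    [∀ i, Fintype (X i)] [∀ i, Fintype (A i)]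
    (P : (∀ i, X i) → (∀ i, A i) → ℝ) : Prop :=
  ∀ (T : Finset ι) (x x' : ∀ i, X i), (∀ i ∈ T, x i = x' i) →
    ∀ a₀ : ∀ i, A i,
      ∑ a ∈ univ.filter (fun a : ∀ i, A i => ∀ i ∈ T, a i = a₀ i), P x a =
      ∑ a ∈ univ.filter (fun a : ∀ i, A i => ∀ i ∈ T, a i = a₀ i), P x' a

/-- A box is bilocal if it is a convex combination, over bipartitions `M | Mᶜ` of the
parties and hidden variables, of products of nonsignalling boxes on the two groups. -/
def Bilocal {ι : Type*} [Fintype ι] [DecidableEq ι] {X A : ι → Type*}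
    [∀ i, Fintype (X i)] [∀ i, Fintype (A i)]
    (P : (∀ i, X i) → (∀ i, A i) → ℝ) : Prop :=
  ∃ (L : ℕ) (M : Fin L → Finset ι) (w : Fin L → ℝ)
    (Q : (l : Fin L) →
      (((j : {j : ι // j ∈ M l}) → X j.1) → ((j : {j : ι // j ∈ M l}) → A j.1) → ℝ))
    (R : (l : Fin L) →
      (((j : {j : ι // j ∉ M l}) → X j.1) → ((j : {j : ι // j ∉ M l}) → A j.1) → ℝ)),
    (∀ l, (M l).Nonempty ∧ M l ≠ Finset.univ) ∧
    (∀ l, 0 ≤ w l) ∧ (∑ l, w l = 1) ∧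
    (∀ l, IsBoxN (Q l) ∧ NonSignalling (Q l)) ∧
    (∀ l, IsBoxN (R l) ∧ NonSignalling (R l)) ∧
    ∀ x a, P x a =
      ∑ l, w l * Q l (fun j => x j.1) (fun j => a j.1) * R l (fun j => x j.1) (fun j => a j.1)

/-- The global index type of a network with `K` edges, where the state on edge `k` lives
on `ℂ^{dL k} ⊗ ℂ^{dR k}`. -/
abbrev NetIdx (K : ℕ) (dL dR : Fin K → ℕ) : Type :=
  ∀ k : Fin K, Fin (dL k) × Fin (dR k)

/-- The index type of the system held by party `i`: one tensor factor for every edge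
incident to `i` (the left factor if `i` is the first endpoint, the right factor if `i`
is the second endpoint). -/
abbrev PartyIdx (n K : ℕ) (ep : Fin K → Fin n × Fin n) (dL dR : Fin K → ℕ)
    (i : Fin n) : Type :=
  ((k : {k : Fin K // (ep k).1 = i}) → Fin (dL k.1)) ×
  ((k : {k : Fin K // (ep k).2 = i}) → Fin (dR k.1))

/-- Projection of a global network index onto the components held by party `i`. -/
def partyProj {n K : ℕ} (ep : Fin K → Fin n × Fin n) {dL dR : Fin K → ℕ} (i : Fin n)
    (g : NetIdx K dL dR) : PartyIdx n K ep dL dR i :=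
  (fun k => (g k.1).1, fun k => (g k.1).2)

section EdgeAbstract

set_option linter.unusedSectionVars false

variable {E F : Type*} [NormedAddCommGroup E] [InnerProductSpace ℂ E] [FiniteDimensional ℂ E]
  [NormedAddCommGroup F] [InnerProductSpace ℂ F] [FiniteDimensional ℂ F]

def ChainBad (T : E →ₗ[ℂ] F) (m : ℕ) (a : ℕ → E) (b : ℕ → F) : ℝ :=
  ∑ j ∈ Finset.range m, (‖T (a j)‖ ^ 2 - ‖inner ℂ (b (j+1)) (T (a j))‖ ^ 2) +
  ∑ j ∈ Finset.range m, (‖LinearMap.adjoint T (b (j+1))‖ ^ 2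
    - ‖inner ℂ (b (j+1)) (T (a (j+1)))‖ ^ 2) +
  ‖inner ℂ (b 0) (T (a m))‖ ^ 2

lemma inner_self_ofReal {V : Type*} [NormedAddCommGroup V] [InnerProductSpace ℂ V] (x : V) :
    inner ℂ x x = ((‖x‖ ^ 2 : ℝ) : ℂ) := by
  rw [inner_self_eq_norm_sq_to_K]; simp

lemma zero_left (T : E →ₗ[ℂ] F) {a : E} {b : F} {r : ℂ} (hb : ‖b‖ = 1) (h : T a = r • b) :
    ‖T a‖ ^ 2 - ‖inner ℂ b (T a)‖ ^ 2 = 0 := by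
  rw [h, inner_smul_right, norm_smul, norm_mul, inner_self_eq_norm_sq_to_K, hb]
  simp

lemma zero_right (T : E →ₗ[ℂ] F) {a : E} {b : F} {r : ℂ} (ha : ‖a‖ = 1)
    (h : LinearMap.adjoint T b = r • a) :
    ‖LinearMap.adjoint T b‖ ^ 2 - ‖inner ℂ b (T a)‖ ^ 2 = 0 := by
  rw [← LinearMap.adjoint_inner_left, h, inner_smul_left, norm_smul, norm_mul,
    inner_self_eq_norm_sq_to_K, ha]
  simp

lemma exists_unit_smul {V : Type*} [NormedAddCommGroup V] [InnerProductSpace ℂ V] {v : V}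
    (hv : v ≠ 0) : ∃ u : V, ‖u‖ = 1 ∧ ∃ r : ℂ, r ≠ 0 ∧ v = r • u ∧ u = r⁻¹ • v := by
  have h : ‖v‖ ≠ 0 := norm_ne_zero_iff.2 hv
  have h' : (‖v‖ : ℂ) ≠ 0 := by exact_mod_cast h
  refine ⟨(‖v‖ : ℂ)⁻¹ • v, ?_, (‖v‖ : ℂ), h', ?_, rfl⟩
  · rw [norm_smul, norm_inv]; simp [h]
  · rw [smul_smul, mul_inv_cancel₀ h', one_smul]

lemma edge_hardy (T : E →ₗ[ℂ] F) (a : E)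
    (h : ¬ ∃ r : ℂ, T (LinearMap.adjoint T (T a)) = r • T a) :
    ∃ (a' : ℕ → E) (b : ℕ → F), (∀ j, ‖a' j‖ = 1) ∧ (∀ j, ‖b j‖ = 1) ∧
      0 < ‖inner ℂ (b 0) (T (a' 0))‖ ^ 2 ∧ ChainBad T 1 a' b = 0 := by
  have hv : T a ≠ 0 := fun h0 => h ⟨0, by simp [h0]⟩
  have ha : a ≠ 0 := by rintro rfl; simp at hv
  have hw : LinearMap.adjoint T (T a) ≠ 0 := by
    intro h0; exact h ⟨0, by simp [h0]⟩
  set u := T (LinearMap.adjoint T (T a)) with hu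
  have hu0 : u ≠ 0 := by
    intro h0; exact h ⟨0, by simp [h0]⟩
  obtain ⟨a0, ha0, r0, hr0, h1, h1'⟩ := exists_unit_smul ha
  obtain ⟨b1, hb1, r1, hr1, h2, h2'⟩ := exists_unit_smul hv
  obtain ⟨a1, ha1, r2, hr2, h3, h3'⟩ := exists_unit_smul hw
  set z : F := T a - (inner ℂ u (T a) / inner ℂ u u) • u with hz
  have huu : inner ℂ u u ≠ 0 := inner_self_ne_zero.2 hu0
  have hz0 : z ≠ 0 := by
    intro h0
    have h4 : T a = (inner ℂ u (T a) / inner ℂ u u) • u := sub_eq_zero.1 h0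
    have h5 : (inner ℂ u (T a) / inner ℂ u u) ≠ 0 := by
      intro h6; rw [h6, zero_smul] at h4; exact hv h4
    refine h ⟨(inner ℂ u (T a) / inner ℂ u u)⁻¹, ?_⟩
    have h6 := congrArg (fun w => (inner ℂ u (T a) / inner ℂ u u)⁻¹ • w) h4
    simp only [smul_smul, inv_mul_cancel₀ h5, one_smul] at h6
    exact h6.symm
  have huz : inner ℂ u z = 0 := by
    rw [hz, inner_sub_right, inner_smul_right, div_mul_cancel₀ _ huu, sub_self]
  have hzu : inner ℂ z u = 0 := inner_eq_zero_symm.1 huz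
  have hzv : inner ℂ z (T a) ≠ 0 := by
    have : T a = z + (inner ℂ u (T a) / inner ℂ u u) • u := by rw [hz]; abel
    rw [this, inner_add_right, inner_smul_right, hzu, mul_zero, add_zero]
    exact inner_self_ne_zero.2 hz0
  obtain ⟨b0, hb0, r3, hr3, h4, h4'⟩ := exists_unit_smul hz0
  refine ⟨fun j => if j = 0 then a0 else a1, fun j => if j = 0 then b0 else b1, ?_, ?_, ?_, ?_⟩
  · intro j; dsimp only; split_ifs <;> assumption
  · intro j; dsimp only; split_ifs <;> assumption
  · have : inner ℂ b0 (T a0) ≠ 0 := by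
      rw [h4', h1', map_smul, inner_smul_left, inner_smul_right]
      simp [hr0, hr3, hzv]
    simpa using (by positivity : 0 < ‖inner ℂ b0 (T a0)‖ ^ 2)
  · have e1 : ‖T a0‖ ^ 2 - ‖inner ℂ b1 (T a0)‖ ^ 2 = 0 := by
      refine zero_left T (r := r0⁻¹ * r1) hb1 ?_
      rw [h1', map_smul, mul_smul, ← h2]
    have e2 : ‖LinearMap.adjoint T b1‖ ^ 2 - ‖inner ℂ b1 (T a1)‖ ^ 2 = 0 := by
      refine zero_right T (r := r1⁻¹ * r2) ha1 ?_
      rw [h2', map_smul, mul_smul, ← h3]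
    have e3 : inner ℂ b0 (T a1) = 0 := by
      rw [h4', h3', map_smul, inner_smul_left, inner_smul_right, hzu]; simp
    simp [ChainBad, e1, e2, e3]

lemma edge_max (T : E →ₗ[ℂ] F) (u v : F) (hu : ‖u‖ = 1) (hv : ‖v‖ = 1)
    (huv : inner ℂ u v = 0) (l : ℝ) (hl : 0 < l)
    (h1 : T (LinearMap.adjoint T u) = (l : ℂ) • u)
    (h2 : T (LinearMap.adjoint T v) = (l : ℂ) • v) (ε : ℝ) (hε : 0 < ε) :
    ∃ (m : ℕ) (a : ℕ → E) (b : ℕ → F), (∀ j, ‖a j‖ = 1) ∧ (∀ j, ‖b j‖ = 1) ∧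
      l ≤ ‖inner ℂ (b 0) (T (a 0))‖ ^ 2 ∧ ChainBad T m a b ≤ ε := by
  have huu : inner ℂ u u = 1 := by rw [inner_self_eq_norm_sq_to_K, hu]; simp
  have hvv : inner ℂ v v = 1 := by rw [inner_self_eq_norm_sq_to_K, hv]; simp
  have hvu : inner ℂ v u = 0 := inner_eq_zero_symm.1 huv
  have hsq : (Real.sqrt l) * Real.sqrt l = l := Real.mul_self_sqrt hl.le
  have hs0 : (Real.sqrt l : ℝ) ≠ 0 := (Real.sqrt_pos.2 hl).ne'
  have hsC : ((Real.sqrt l : ℝ) : ℂ) ≠ 0 := by exact_mod_cast hs0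
  have hsqC : ((Real.sqrt l : ℝ) : ℂ) * (Real.sqrt l : ℝ) = l := by exact_mod_cast hsq
  set B : ℝ → F := fun θ => ((Real.cos θ : ℝ) : ℂ) • u + ((Real.sin θ : ℝ) : ℂ) • v with hB
  have hBB : ∀ θ φ, inner ℂ (B θ) (B φ) = ((Real.cos (φ - θ) : ℝ) : ℂ) := by
    intro θ φ
    simp only [hB, inner_add_left, inner_add_right, inner_smul_left, inner_smul_right,
      huu, hvv, huv, hvu, Complex.conj_ofReal, Real.cos_sub]
    push_cast; ring
  have hTB : ∀ θ, T (LinearMap.adjoint T (B θ)) = (l : ℂ) • B θ := by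
    intro θ
    simp only [hB, map_add, map_smul, h1, h2, smul_add]
    rw [smul_comm, smul_comm (l : ℂ) _ v]
  set A : ℝ → E := fun θ => ((Real.sqrt l : ℝ) : ℂ)⁻¹ • LinearMap.adjoint T (B θ) with hA
  have hTA : ∀ θ, T (A θ) = ((Real.sqrt l : ℝ) : ℂ) • B θ := by
    intro θ
    simp only [hA, map_smul, hTB, smul_smul]
    congr 1
    rw [← hsqC]; field_simp
  have hnB : ∀ θ, ‖B θ‖ = 1 := by
    intro θ
    have := hBB θ θ
    rw [inner_self_ofReal, sub_self, Real.cos_zero] at this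
    have h3 : ‖B θ‖ ^ 2 = 1 := by exact_mod_cast this
    nlinarith [norm_nonneg (B θ)]
  have hadj : ∀ θ, ‖LinearMap.adjoint T (B θ)‖ ^ 2 = l := by
    intro θ
    have : inner ℂ (LinearMap.adjoint T (B θ)) (LinearMap.adjoint T (B θ)) = (l : ℂ) := by
      rw [LinearMap.adjoint_inner_left, hTB, inner_smul_right, hBB]; simp
    rw [inner_self_ofReal] at this
    exact_mod_cast this
  have hnA : ∀ θ, ‖A θ‖ = 1 := by
    intro θ
    have h3 : ‖A θ‖ ^ 2 = 1 := by
      rw [hA]; simp only [norm_smul, mul_pow, hadj, norm_inv, Complex.norm_real, inv_pow]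
      rw [Real.norm_eq_abs, sq_abs, pow_two, hsq, inv_mul_cancel₀ hl.ne']
    nlinarith [norm_nonneg (A θ)]
  have hin : ∀ θ φ, ‖inner ℂ (B θ) (T (A φ))‖ ^ 2 = l * Real.cos (φ - θ) ^ 2 := by
    intro θ φ
    rw [hTA, inner_smul_right, hBB, norm_mul, Complex.norm_real, Complex.norm_real, mul_pow,
      Real.norm_eq_abs, Real.norm_eq_abs, sq_abs, sq_abs, pow_two, hsq]
  obtain ⟨N, hN⟩ := exists_nat_gt (l * Real.pi ^ 2 / (4 * ε))
  have hN0 : (0 : ℝ) < N := lt_of_le_of_lt (by positivity) hN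
  set δ : ℝ := Real.pi / (2 * N) with hδ
  refine ⟨N, fun j => A (j * δ), fun j => B (((j - 1 : ℕ) : ℝ) * δ), fun j => hnA _,
    fun j => hnB _, ?_, ?_⟩
  · rw [hin]; simp
  · unfold ChainBad
    have e1 : ∀ j ∈ Finset.range N, (‖T (A ((j : ℕ) * δ))‖ ^ 2 -
        ‖inner ℂ (B (((j + 1 - 1 : ℕ) : ℝ) * δ)) (T (A (j * δ)))‖ ^ 2) = 0 := by
      intro j _
      refine zero_left T (r := ((Real.sqrt l : ℝ) : ℂ)) (hnB _) ?_
      rw [hTA]; simp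
    rw [Finset.sum_eq_zero e1]
    have e2 : ∀ j ∈ Finset.range N, (‖LinearMap.adjoint T (B (((j + 1 - 1 : ℕ) : ℝ) * δ))‖ ^ 2 -
        ‖inner ℂ (B (((j + 1 - 1 : ℕ) : ℝ) * δ)) (T (A (((j + 1 : ℕ) : ℝ) * δ)))‖ ^ 2) ≤ l * δ ^ 2 := by
      intro j _
      rw [hadj, hin]
      have : ((j + 1 : ℕ) : ℝ) * δ - (((j + 1 - 1 : ℕ) : ℝ) * δ) = δ := by
        simp; ring
      rw [this]
      have h5 : Real.sin δ ^ 2 ≤ δ ^ 2 := by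
        rw [sq_le_sq]; exact Real.abs_sin_le_abs
      have h6 := Real.sin_sq_add_cos_sq δ
      nlinarith
    have e3 : ‖inner ℂ (B (((0 - 1 : ℕ) : ℝ) * δ)) (T (A ((N : ℝ) * δ)))‖ ^ 2 = 0 := by
      rw [hin]
      have : (N : ℝ) * δ - (((0 - 1 : ℕ) : ℝ) * δ) = Real.pi / 2 := by
        rw [hδ]; simp; field_simp
      rw [this]; simp
    rw [e3]
    have e4 := Finset.sum_le_sum e2
    rw [Finset.sum_const, Finset.card_range, nsmul_eq_mul] at e4
    have e5 : (N : ℝ) * (l * δ ^ 2) ≤ ε := by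
      have : (N : ℝ) * (l * δ ^ 2) = (l * Real.pi ^ 2 / 4) / N := by
        rw [hδ]; field_simp; ring
      rw [this, div_le_iff₀ hN0]
      rw [div_lt_iff₀ (by positivity)] at hN
      linarith
    linarith

lemma edge_abstract (T : E →ₗ[ℂ] F) (x y : E) (hx : ‖T x‖ = 1) (hy : ‖T y‖ = 1)
    (hxy : inner ℂ (T x) (T y) = 0) :
    ∃ p : ℝ, 0 < p ∧ ∀ ε : ℝ, 0 < ε → ∃ (m : ℕ) (a : ℕ → E) (b : ℕ → F),
      (∀ j, ‖a j‖ = 1) ∧ (∀ j, ‖b j‖ = 1) ∧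
      p ≤ ‖inner ℂ (b 0) (T (a 0))‖ ^ 2 ∧ ChainBad T m a b ≤ ε := by
  by_cases h : ∀ a, ∃ r : ℂ, T (LinearMap.adjoint T (T a)) = r • T a
  · obtain ⟨r1, h1⟩ := h x
    obtain ⟨r2, h2⟩ := h y
    obtain ⟨r3, h3⟩ := h (x + y)
    have hxx : inner ℂ (T x) (T x) = 1 := by rw [inner_self_eq_norm_sq_to_K, hx]; simp
    have hyy : inner ℂ (T y) (T y) = 1 := by rw [inner_self_eq_norm_sq_to_K, hy]; simp
    have hyx : inner ℂ (T y) (T x) = 0 := inner_eq_zero_symm.1 hxy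
    simp only [map_add, h1, h2] at h3
    simp only [smul_add] at h3
    have h4 := congrArg (fun w => inner ℂ (T x) w) h3
    have h5 := congrArg (fun w => inner ℂ (T y) w) h3
    simp only [inner_add_right, inner_smul_right, hxx, hyy, hxy, hyx, mul_one, mul_zero,
      add_zero, zero_add] at h4 h5
    have hr : r1 = ((‖LinearMap.adjoint T (T x)‖ ^ 2 : ℝ) : ℂ) := by
      have := LinearMap.adjoint_inner_left T (LinearMap.adjoint T (T x)) (T x)
      rw [h1, inner_smul_right, hxx, inner_self_eq_norm_sq_to_K] at this
      rw [mul_one] at this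
      rw [← this]; simp
    have hpos : 0 < ‖LinearMap.adjoint T (T x)‖ ^ 2 := by
      have : LinearMap.adjoint T (T x) ≠ 0 := by
        intro h0
        have := LinearMap.adjoint_inner_left T x (T x)
        rw [h0, inner_zero_left, hxx] at this
        exact zero_ne_one this
      positivity
    refine ⟨_, hpos, fun ε hε => ?_⟩
    refine edge_max T (T x) (T y) hx hy hxy _ hpos (by rw [h1, hr]) (by rw [h2, h5, ← h4, hr]) ε hε
  · push Not at h
    obtain ⟨a, ha⟩ := h
    obtain ⟨a', b, h1, h2, h3, h4⟩ := edge_hardy T a (by push Not; exact ha)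
    exact ⟨_, h3, fun ε hε => ⟨1, a', b, h1, h2, le_rfl, by rw [h4]; exact hε.le⟩⟩

end EdgeAbstract

section EdgeConcrete

/-- The value `⟨ψ| A ⊗ B |ψ⟩`. -/
def edgeVal {L R : Type*} [Fintype L] [Fintype R] (A : Matrix L L ℂ) (B : Matrix R R ℂ)
    (ψ : L × R → ℂ) : ℂ :=
  ∑ q : L × R, ∑ q' : L × R, A q.1 q'.1 * B q.2 q'.2 * (ψ q' * star (ψ q))

variable {d e : ℕ}

lemma edgeVal_sub_left {L R : Type*} [Fintype L] [Fintype R] (A A' : Matrix L L ℂ)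
    (B : Matrix R R ℂ) (ψ : L × R → ℂ) :
    edgeVal (A - A') B ψ = edgeVal A B ψ - edgeVal A' B ψ := by
  simp only [edgeVal, ← Finset.sum_sub_distrib, Matrix.sub_apply]
  refine Finset.sum_congr rfl fun _ _ => Finset.sum_congr rfl fun _ _ => ?_
  ring

lemma edgeVal_sub_right {L R : Type*} [Fintype L] [Fintype R] (A : Matrix L L ℂ)
    (B B' : Matrix R R ℂ) (ψ : L × R → ℂ) :
    edgeVal A (B - B') ψ = edgeVal A B ψ - edgeVal A B' ψ := by
  simp only [edgeVal, ← Finset.sum_sub_distrib, Matrix.sub_apply]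
  refine Finset.sum_congr rfl fun _ _ => Finset.sum_congr rfl fun _ _ => ?_
  ring

lemma edgeVal_nonneg {L R : Type*} [Fintype L] [Fintype R] {A : Matrix L L ℂ}
    {B : Matrix R R ℂ} (hA : A.PosSemidef) (hB : B.PosSemidef) (ψ : L × R → ℂ) :
    0 ≤ edgeVal A B ψ := by
  have h := (hA.kronecker hB).dotProduct_mulVec_nonneg ψ
  convert h using 1
  simp only [edgeVal, dotProduct, Matrix.mulVec, Finset.mul_sum]
  refine Finset.sum_congr rfl fun q _ => Finset.sum_congr rfl fun q' _ => ?_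
  simp [Matrix.kroneckerMap_apply]; ring

/-- The operator of a pure state. -/
def stateOp (ψ : Fin d × Fin e → ℂ) :
    EuclideanSpace ℂ (Fin d) →ₗ[ℂ] EuclideanSpace ℂ (Fin e) :=
  Matrix.toEuclideanLin (Matrix.of fun j i => ψ (i, j))

lemma stateOp_apply (ψ : Fin d × Fin e → ℂ) (a : EuclideanSpace ℂ (Fin d)) (j : Fin e) :
    stateOp ψ a j = ∑ i, ψ (i, j) * a i := by
  simp [stateOp, Matrix.toLpLin_apply, Matrix.mulVec, dotProduct]

lemma stateOp_adjoint_apply (ψ : Fin d × Fin e → ℂ) (b : EuclideanSpace ℂ (Fin e)) (i : Fin d) :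
    LinearMap.adjoint (stateOp ψ) b i = ∑ j, star (ψ (i, j)) * b j := by
  rw [stateOp, ← Matrix.toEuclideanLin_conjTranspose_eq_adjoint]
  simp [Matrix.toLpLin_apply, Matrix.mulVec, dotProduct]

/-- projector of the conjugated vector -/
def projA (a : EuclideanSpace ℂ (Fin d)) : Matrix (Fin d) (Fin d) ℂ :=
  vecProj (fun i => star (a i))

def projB (b : EuclideanSpace ℂ (Fin e)) : Matrix (Fin e) (Fin e) ℂ :=
  vecProj (fun i => b i)

lemma norm_sq_eq_star_mul (z : ℂ) : ((‖z‖ ^ 2 : ℝ) : ℂ) = star z * z := by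
  have := Complex.conj_mul' z
  simp [← this]

lemma euclid_norm_sq (v : EuclideanSpace ℂ (Fin e)) :
    ((‖v‖ ^ 2 : ℝ) : ℂ) = ∑ j, star (v j) * v j := by
  rw [EuclideanSpace.norm_sq_eq]
  push_cast
  refine Finset.sum_congr rfl fun j _ => ?_
  rw [← norm_sq_eq_star_mul]; push_cast; rfl

lemma edgeVal_projA_projB (ψ : Fin d × Fin e → ℂ) (a : EuclideanSpace ℂ (Fin d))
    (b : EuclideanSpace ℂ (Fin e)) :
    edgeVal (projA a) (projB b) ψ = ((‖inner ℂ b (stateOp ψ a)‖ ^ 2 : ℝ) : ℂ) := by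
  have h : inner ℂ b (stateOp ψ a) = ∑ q : Fin d × Fin e, ψ q * a q.1 * star (b q.2) := by
    rw [Fintype.sum_prod_type_right]
    simp only [PiLp.inner_apply, stateOp_apply, RCLike.inner_apply, Finset.sum_mul]
    rfl
  rw [norm_sq_eq_star_mul, h, star_sum, Finset.sum_mul_sum, edgeVal]
  refine Finset.sum_congr rfl fun q _ => Finset.sum_congr rfl fun q' _ => ?_
  simp [projA, projB, vecProj]; ring

lemma edgeVal_projA_one (ψ : Fin d × Fin e → ℂ) (a : EuclideanSpace ℂ (Fin d)) :
    edgeVal (projA a) 1 ψ = ((‖stateOp ψ a‖ ^ 2 : ℝ) : ℂ) := by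
  rw [euclid_norm_sq, edgeVal]
  simp only [stateOp_apply, star_sum, Finset.sum_mul_sum, Fintype.sum_prod_type_right]
  refine Finset.sum_congr rfl fun j _ => Finset.sum_congr rfl fun i _ => ?_
  rw [Finset.sum_comm]
  refine Finset.sum_congr rfl fun i' _ => ?_
  rw [Finset.sum_eq_single j]
  · simp [projA, vecProj]; ring
  · intro j' _ h; simp [h.symm]
  · simp

lemma edgeVal_one_projB (ψ : Fin d × Fin e → ℂ) (b : EuclideanSpace ℂ (Fin e)) :
    edgeVal 1 (projB b) ψ = ((‖LinearMap.adjoint (stateOp ψ) b‖ ^ 2 : ℝ) : ℂ) := by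
  rw [euclid_norm_sq, edgeVal]
  simp only [stateOp_adjoint_apply, star_sum, Finset.sum_mul_sum, Fintype.sum_prod_type]
  refine Finset.sum_congr rfl fun i _ => ?_
  rw [Finset.sum_comm]
  rw [Finset.sum_eq_single i]
  · rw [Finset.sum_comm]
    refine Finset.sum_congr rfl fun j _ => Finset.sum_congr rfl fun j' _ => ?_
    simp [projB, vecProj]; ring
  · intro j' _ h; simp [h.symm]
  · simp

lemma edgeVal_one_one {L R : Type*} [Fintype L] [Fintype R] [DecidableEq L] [DecidableEq R] (ψ : L × R → ℂ) (h : UnitVec ψ) :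
    edgeVal 1 1 ψ = 1 := by
  rw [edgeVal, ← h]
  refine Finset.sum_congr rfl fun q _ => ?_
  rw [Finset.sum_eq_single q]
  · simp [mul_comm]
  · intro q' _ hq
    rcases q with ⟨i, j⟩
    rcases q' with ⟨i', j'⟩
    simp only [Matrix.one_apply]
    by_cases h1 : i = i'
    · by_cases h2 : j = j'
      · subst h1 h2; exact absurd rfl hq
      · simp [h2]
    · simp [h1]
  · simp

lemma vecProj_herm {D : Type*} [Fintype D] (v : D → ℂ) : (vecProj v)ᴴ = vecProj v := by
  ext i j; simp [vecProj, mul_comm]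

lemma vecProj_idem {D : Type*} [Fintype D] (v : D → ℂ) (h : ∑ i, star (v i) * v i = 1) :
    vecProj v * vecProj v = vecProj v := by
  ext i j
  simp only [vecProj, Matrix.mul_apply, Matrix.of_apply]
  calc _ = ∑ x, (v i * star (v j)) * (star (v x) * v x) :=
        Finset.sum_congr rfl fun x _ => by ring
    _ = _ := by rw [← Finset.mul_sum, h, mul_one]

/-- projector property -/
def IsProjM {D : Type*} [Fintype D] (A : Matrix D D ℂ) : Prop := Aᴴ = A ∧ A * A = A

lemma IsProjM.compl {D : Type*} [Fintype D] [DecidableEq D] {A : Matrix D D ℂ} (h : IsProjM A) :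
    IsProjM (1 - A) := by
  refine ⟨by simp [h.1], ?_⟩
  rw [sub_mul, mul_sub, mul_sub, h.2]; simp

lemma IsProjM.posSemidef {D : Type*} [Fintype D] {A : Matrix D D ℂ} (h : IsProjM A) :
    A.PosSemidef := by
  have := Matrix.posSemidef_conjTranspose_mul_self A
  rwa [h.1, h.2] at this

lemma projB_proj (b : EuclideanSpace ℂ (Fin e)) (h : ‖b‖ = 1) : IsProjM (projB b) := by
  refine ⟨vecProj_herm _, vecProj_idem _ ?_⟩
  rw [← euclid_norm_sq, h]; simp

lemma projA_proj (b : EuclideanSpace ℂ (Fin e)) (h : ‖b‖ = 1) : IsProjM (projA b) := by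
  refine ⟨vecProj_herm _, vecProj_idem _ ?_⟩
  have := euclid_norm_sq b
  rw [h] at this
  simp only [star_star]
  simp only [mul_comm (b _)]
  rw [← this]; simp

/-- the total bad weight of the chain -/
def edgeBad {L R : Type*} [Fintype L] [Fintype R] [DecidableEq L] [DecidableEq R] (ψ : L × R → ℂ) (m : ℕ)
    (A : ℕ → Matrix L L ℂ) (B : ℕ → Matrix R R ℂ) : ℝ :=
  ∑ j ∈ Finset.range m, (edgeVal (A j) (1 - B (j+1)) ψ).re +
  ∑ j ∈ Finset.range m, (edgeVal (1 - A (j+1)) (B (j+1)) ψ).re +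
  (edgeVal (A m) (B 0) ψ).re

lemma edge_exists_orth (ψ : Fin d × Fin e → ℂ)
    (hent : ¬ ∃ (α : Fin d → ℂ) (β : Fin e → ℂ),
      ∀ q : Fin d × Fin e, ψ q = α q.1 * β q.2) :
    ∃ x y, ‖stateOp ψ x‖ = 1 ∧ ‖stateOp ψ y‖ = 1 ∧ inner ℂ (stateOp ψ x) (stateOp ψ y) = 0 := by
  set T := stateOp ψ with hT
  have hTe : ∀ i j, T (EuclideanSpace.single i 1) j = ψ (i, j) := by
    intro i j
    rw [hT, stateOp_apply]
    simp [PiLp.single_apply]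
  have hx : ∃ x, T x ≠ 0 := by
    by_contra hc
    push Not at hc
    refine hent ⟨0, 0, fun q => ?_⟩
    have := hTe q.1 q.2
    rw [hc] at this
    simpa using this.symm
  obtain ⟨x, hx⟩ := hx
  obtain ⟨u, hu, r, hr, h1, h1'⟩ := exists_unit_smul hx
  have hy : ∃ y, T y - inner ℂ u (T y) • u ≠ 0 := by
    by_contra hc
    push Not at hc
    refine hent ⟨fun i => inner ℂ u (T (EuclideanSpace.single i 1)), fun j => u j, fun q => ?_⟩
    have h2 := sub_eq_zero.1 (hc (EuclideanSpace.single q.1 1))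
    have h3 := congrArg (fun w : EuclideanSpace ℂ (Fin e) => w q.2) h2
    simp only [hTe] at h3
    simpa using h3
  obtain ⟨y, hy⟩ := hy
  obtain ⟨v, hv, s, hs, h2, h2'⟩ := exists_unit_smul hy
  have e1 : T (r⁻¹ • x) = u := by rw [map_smul, ← h1']
  have e2 : T (s⁻¹ • (y - inner ℂ u (T y) • (r⁻¹ • x))) = v := by
    rw [map_smul, map_sub, map_smul, e1, ← h2']
  refine ⟨r⁻¹ • x, s⁻¹ • (y - inner ℂ u (T y) • (r⁻¹ • x)), ?_, ?_, ?_⟩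
  · rw [e1, hu]
  · rw [e2, hv]
  · rw [e1, e2, h2', inner_smul_right, inner_sub_right, inner_smul_right, inner_self_ofReal, hu]
    simp

lemma edge_concrete (ψ : Fin d × Fin e → ℂ)
    (hent : ¬ ∃ (α : Fin d → ℂ) (β : Fin e → ℂ),
      ∀ q : Fin d × Fin e, ψ q = α q.1 * β q.2) :
    ∃ p : ℝ, 0 < p ∧ ∀ ε : ℝ, 0 < ε → ∃ (m : ℕ) (A : ℕ → Matrix (Fin d) (Fin d) ℂ)
      (B : ℕ → Matrix (Fin e) (Fin e) ℂ), (∀ j, IsProjM (A j)) ∧ (∀ j, IsProjM (B j)) ∧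
      p ≤ (edgeVal (A 0) (B 0) ψ).re ∧ edgeBad ψ m A B ≤ ε := by
  obtain ⟨x, y, h1, h2, h3⟩ := edge_exists_orth ψ hent
  obtain ⟨p, hp, H⟩ := edge_abstract (stateOp ψ) x y h1 h2 h3
  refine ⟨p, hp, fun ε hε => ?_⟩
  obtain ⟨m, a, b, ha, hb, h4, h5⟩ := H ε hε
  refine ⟨m, fun j => projA (a j), fun j => projB (b j), fun j => projA_proj _ (ha j),
    fun j => projB_proj _ (hb j), ?_, ?_⟩
  · rw [edgeVal_projA_projB, Complex.ofReal_re]; exact h4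
  · refine le_trans (le_of_eq ?_) h5
    simp only [edgeBad, ChainBad, edgeVal_sub_left, edgeVal_sub_right, edgeVal_projA_projB,
      edgeVal_projA_one, edgeVal_one_projB, Complex.sub_re, Complex.ofReal_re]

end EdgeConcrete

section BilocalAbstract

/-- The elementary local chain inequality. -/
lemma local_chain (α β : ℕ → ℝ) (hα0 : ∀ j, 0 ≤ α j) (hα1 : ∀ j, α j ≤ 1)
    (hβ0 : ∀ j, 0 ≤ β j) (hβ1 : ∀ j, β j ≤ 1) (m : ℕ) :
    α 0 * β 0 ≤ ∑ j ∈ Finset.range m, α j * (1 - β (j+1)) +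
      ∑ j ∈ Finset.range m, (1 - α (j+1)) * β (j+1) + α m * β 0 := by
  induction m with
  | zero => simp
  | succ m ih =>
    rw [Finset.sum_range_succ, Finset.sum_range_succ]
    have h1 := hα0 m
    have h2 := hα1 m
    have h3 := hα0 (m+1)
    have h4 := hα1 (m+1)
    have h5 := hβ0 (m+1)
    have h6 := hβ1 (m+1)
    have h7 := hβ0 0
    have h8 := hβ1 0
    have k1 : α m - α (m+1) ≤ α m * (1 - β (m+1)) + (1 - α (m+1)) * β (m+1) := by
      nlinarith [mul_nonneg h5 (sub_nonneg.2 h2), mul_nonneg h3 (sub_nonneg.2 h6)]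
    have k2 : 0 ≤ α m * (1 - β (m+1)) + (1 - α (m+1)) * β (m+1) :=
      add_nonneg (mul_nonneg h1 (sub_nonneg.2 h6)) (mul_nonneg (sub_nonneg.2 h4) h5)
    have k3 : β 0 * (α m - α (m+1)) ≤ α m * (1 - β (m+1)) + (1 - α (m+1)) * β (m+1) := by
      have := mul_le_mul_of_nonneg_left k1 h7
      have := mul_le_mul_of_nonneg_right h8 k2
      linarith
    linarith

lemma ns_marginal {ι : Type*} [Fintype ι] [DecidableEq ι] {X A : ι → Type*}
    [∀ i, Fintype (X i)] [∀ i, Fintype (A i)]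
    (Q : (∀ i, X i) → (∀ i, A i) → ℝ) (hQ : IsBoxN Q) (hns : NonSignalling Q)
    (x0 : ∀ i, X i) (i : ι) :
    ∃ q : X i → A i → ℝ, (∀ s α, 0 ≤ q s α) ∧ (∀ s, ∑ α, q s α = 1) ∧
      ∀ x (f : A i → ℝ), ∑ a, f (a i) * Q x a = ∑ α, f α * q (x i) α := by
  have key : ∀ x (f : A i → ℝ), ∑ a, f (a i) * Q x a = ∑ α, f α *
      ∑ a ∈ univ.filter (fun a : ∀ i, A i => a i = α), Q (Function.update x0 i (x i)) a := by
    intro x f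
    rw [← Finset.sum_fiberwise (s := univ) (g := fun a : ∀ i, A i => a i)]
    refine Finset.sum_congr rfl fun α _ => ?_
    rw [Finset.mul_sum]
    have h1 : ∀ y : ∀ i, X i, ∑ a ∈ univ.filter (fun a : ∀ i, A i => a i = α), f (a i) * Q y a =
        f α * ∑ a ∈ univ.filter (fun a : ∀ i, A i => a i = α), Q y a := by
      intro y
      rw [Finset.mul_sum]
      refine Finset.sum_congr rfl fun a ha => ?_
      rw [(Finset.mem_filter.1 ha).2]
    rw [h1, ← Finset.mul_sum]
    congr 1
    by_cases h : ∃ a₀ : ∀ i, A i, a₀ i = α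
    · obtain ⟨a₀, rfl⟩ := h
      have := hns {i} x (Function.update x0 i (x i)) (by simp) a₀
      simpa using this
    · have : univ.filter (fun a : ∀ i, A i => a i = α) = ∅ := by
        rw [Finset.filter_eq_empty_iff]
        exact fun a _ ha => h ⟨a, ha⟩
      rw [this]; simp
  refine ⟨fun s α => ∑ a ∈ univ.filter (fun a : ∀ i, A i => a i = α),
    Q (Function.update x0 i s) a, fun s α => Finset.sum_nonneg fun a _ => hQ.1 _ _, fun s => ?_, key⟩
  have := key (Function.update x0 i s) (fun _ => 1)
  simp only [one_mul, Function.update_self] at this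
  rw [← this]; exact hQ.2 _

lemma product_marginal {ι : Type*} [Fintype ι] [DecidableEq ι] {X A : ι → Type*}
    [∀ i, Fintype (X i)] [∀ i, Fintype (A i)] (M : Finset ι)
    (Q : ((j : {j : ι // j ∈ M}) → X j.1) → ((j : {j : ι // j ∈ M}) → A j.1) → ℝ)
    (R : ((j : {j : ι // j ∉ M}) → X j.1) → ((j : {j : ι // j ∉ M}) → A j.1) → ℝ)
    (hQ : IsBoxN Q) (hQn : NonSignalling Q) (hR : IsBoxN R) (hRn : NonSignalling R)
    (x0 : ∀ i, X i) (i j : ι) (hi : i ∈ M) (hj : j ∉ M) :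
    ∃ (q : X i → A i → ℝ) (r : X j → A j → ℝ), (∀ s α, 0 ≤ q s α) ∧ (∀ s, ∑ α, q s α = 1) ∧
      (∀ s α, 0 ≤ r s α) ∧ (∀ s, ∑ α, r s α = 1) ∧
      ∀ (x : ∀ i, X i) (f : A i → ℝ) (g : A j → ℝ), ∑ a : ∀ i, A i, f (a i) * g (a j) *
        (Q (fun j => x j.1) (fun j => a j.1) * R (fun j => x j.1) (fun j => a j.1)) =
        (∑ α, f α * q (x i) α) * (∑ β, g β * r (x j) β) := by
  obtain ⟨q, hq0, hq1, hq⟩ := ns_marginal Q hQ hQn (fun j => x0 j.1) ⟨i, hi⟩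
  obtain ⟨r, hr0, hr1, hr⟩ := ns_marginal R hR hRn (fun j => x0 j.1) ⟨j, hj⟩
  refine ⟨q, r, hq0, hq1, hr0, hr1, fun x f g => ?_⟩
  have h1 := hq (fun j => x j.1) f
  have h2 := hr (fun j => x j.1) g
  rw [← h1, ← h2, Finset.sum_mul_sum, ← Finset.sum_product', Finset.univ_product_univ]
  refine Fintype.sum_equiv (Equiv.piEquivPiSubtypeProd (fun j => j ∈ M) A) _ _ fun a => ?_
  simp only [Equiv.piEquivPiSubtypeProd]
  dsimp
  ring

/-- two-party weighted marginal -/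
def marg {ι : Type*} [Fintype ι] [DecidableEq ι] {X A : ι → Type*} [∀ i, Fintype (A i)]
    (P : (∀ i, X i) → (∀ i, A i) → ℝ) (i j : ι) (x : ∀ i, X i) (f : A i → ℝ) (g : A j → ℝ) : ℝ :=
  ∑ a : ∀ i, A i, f (a i) * g (a j) * P x a

def chainBadBox {ι : Type*} [Fintype ι] [DecidableEq ι] {X A : ι → Type*} [∀ i, Fintype (A i)]
    (P : (∀ i, X i) → (∀ i, A i) → ℝ) (i j : ι) (x : ℕ → ℕ → ∀ i, X i)
    (f : A i → ℝ) (g : A j → ℝ) (m : ℕ) : ℝ :=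
  ∑ s ∈ Finset.range m, marg P i j (x s (s+1)) f (1 - g) +
  ∑ s ∈ Finset.range m, marg P i j (x (s+1) (s+1)) (1 - f) g +
  marg P i j (x m 0) f g

lemma marg_nonneg {ι : Type*} [Fintype ι] [DecidableEq ι] {X A : ι → Type*} [∀ i, Fintype (A i)]
    (P : (∀ i, X i) → (∀ i, A i) → ℝ) (hP : ∀ x a, 0 ≤ P x a) (i j : ι) (x : ∀ i, X i)
    (f : A i → ℝ) (g : A j → ℝ) (hf : ∀ a, 0 ≤ f a) (hg : ∀ a, 0 ≤ g a) :
    0 ≤ marg P i j x f g :=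
  Finset.sum_nonneg fun a _ => mul_nonneg (mul_nonneg (hf _) (hg _)) (hP _ _)

lemma chainBadBox_nonneg {ι : Type*} [Fintype ι] [DecidableEq ι] {X A : ι → Type*}
    [∀ i, Fintype (A i)]
    (P : (∀ i, X i) → (∀ i, A i) → ℝ) (hP : ∀ x a, 0 ≤ P x a) (i j : ι) (x : ℕ → ℕ → ∀ i, X i)
    (f : A i → ℝ) (g : A j → ℝ) (hf : ∀ a, 0 ≤ f a) (hg : ∀ a, 0 ≤ g a)
    (hf1 : ∀ a, f a ≤ 1) (hg1 : ∀ a, g a ≤ 1) (m : ℕ) :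
    0 ≤ chainBadBox P i j x f g m := by
  refine add_nonneg (add_nonneg (Finset.sum_nonneg fun s _ => ?_)
    (Finset.sum_nonneg fun s _ => ?_)) ?_
  · exact marg_nonneg P hP _ _ _ _ _ hf (fun a => sub_nonneg.2 (hg1 a))
  · exact marg_nonneg P hP _ _ _ _ _ (fun a => sub_nonneg.2 (hf1 a)) hg
  · exact marg_nonneg P hP _ _ _ _ _ hf hg

/-- If the two-party marginals are of product form, then the chain inequality holds. -/
lemma chain_of_product {ι : Type*} [Fintype ι] [DecidableEq ι] {X A : ι → Type*}
    [∀ i, Fintype (A i)]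
    (P : (∀ i, X i) → (∀ i, A i) → ℝ) (hP : ∀ x a, 0 ≤ P x a) (i j : ι) (x : ℕ → ℕ → ∀ i, X i)
    (f : A i → ℝ) (g : A j → ℝ) (hf : ∀ a, 0 ≤ f a) (hg : ∀ a, 0 ≤ g a)
    (hf1 : ∀ a, f a ≤ 1) (hg1 : ∀ a, g a ≤ 1) (m : ℕ)
    (hxi : ∀ s t, x s t i = x s 0 i) (hxj : ∀ s t, x s t j = x 0 t j)
    (a0 : ∀ i, A i) (hfa : f (a0 i) = 1) (hga : g (a0 j) = 1)
    (q : X i → A i → ℝ) (r : X j → A j → ℝ) (hq0 : ∀ s α, 0 ≤ q s α) (hq1 : ∀ s, ∑ α, q s α = 1)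
    (hr0 : ∀ s α, 0 ≤ r s α) (hr1 : ∀ s, ∑ α, r s α = 1)
    (h : ∀ x (f : A i → ℝ) (g : A j → ℝ), marg P i j x f g =
        (∑ α, f α * q (x i) α) * (∑ β, g β * r (x j) β)) :
    P (x 0 0) a0 ≤ chainBadBox P i j x f g m := by
  have h1 : P (x 0 0) a0 ≤ marg P i j (x 0 0) f g := by
    have := Finset.single_le_sum (f := fun a : ∀ i, A i => f (a i) * g (a j) * P (x 0 0) a)
      (fun a _ => mul_nonneg (mul_nonneg (hf _) (hg _)) (hP _ _)) (Finset.mem_univ a0)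
    simpa [marg, hfa, hga] using this
  refine h1.trans ?_
  have cf : ∀ s, ∑ α, (1 - f) α * q s α = 1 - ∑ α, f α * q s α := by
    intro s
    rw [← hq1 s, ← Finset.sum_sub_distrib]
    exact Finset.sum_congr rfl fun _ _ => by simp [sub_mul]
  have cg : ∀ s, ∑ α, (1 - g) α * r s α = 1 - ∑ α, g α * r s α := by
    intro s
    rw [← hr1 s, ← Finset.sum_sub_distrib]
    exact Finset.sum_congr rfl fun _ _ => by simp [sub_mul]
  have bf : ∀ s, ∑ α, f α * q s α ≤ 1 := by
    intro s
    rw [← hq1 s]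
    exact Finset.sum_le_sum fun α _ => mul_le_of_le_one_left (hq0 _ _) (hf1 _)
  have bg : ∀ s, ∑ α, g α * r s α ≤ 1 := by
    intro s
    rw [← hr1 s]
    exact Finset.sum_le_sum fun α _ => mul_le_of_le_one_left (hr0 _ _) (hg1 _)
  have := local_chain (fun s => ∑ α, f α * q (x s 0 i) α) (fun t => ∑ β, g β * r (x 0 t j) β)
    (fun s => Finset.sum_nonneg fun α _ => mul_nonneg (hf _) (hq0 _ _)) (fun s => bf _)
    (fun s => Finset.sum_nonneg fun α _ => mul_nonneg (hg _) (hr0 _ _)) (fun s => bg _) m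
  have e1 : ∀ s, x s (s+1) j = x 0 (s+1) j := fun s => hxj _ _
  have e2 : ∀ s, x (s+1) (s+1) j = x 0 (s+1) j := fun s => hxj _ _
  have e3 : ∀ s, x s (s+1) i = x s 0 i := fun s => hxi _ _
  have e4 : ∀ s, x (s+1) (s+1) i = x (s+1) 0 i := fun s => hxi _ _
  simp only [chainBadBox, h, cf, cg, e1, e2, e3, e4, hxj m 0]
  exact this

theorem not_bilocal_abstract {n K : ℕ} (ep : Fin K → Fin n × Fin n)
    (hcut : ∀ M : Finset (Fin n), M.Nonempty → M ≠ univ →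
      ∃ k, ((ep k).1 ∈ M ∧ (ep k).2 ∉ M) ∨ ((ep k).2 ∈ M ∧ (ep k).1 ∉ M))
    {X A : Fin n → Type*} [∀ i, Fintype (X i)] [∀ i, Fintype (A i)]
    (P : (∀ i, X i) → (∀ i, A i) → ℝ) (m : Fin K → ℕ)
    (x0 : ∀ i, X i) (a0 : ∀ i, A i) (x : Fin K → ℕ → ℕ → ∀ i, X i)
    (hx0 : ∀ k, x k 0 0 = x0)
    (hxi : ∀ k s t, x k s t (ep k).1 = x k s 0 (ep k).1)
    (hxj : ∀ k s t, x k s t (ep k).2 = x k 0 t (ep k).2)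
    (f : ∀ k, A (ep k).1 → ℝ) (g : ∀ k, A (ep k).2 → ℝ)
    (hf : ∀ k a, 0 ≤ f k a) (hg : ∀ k a, 0 ≤ g k a)
    (hf1 : ∀ k a, f k a ≤ 1) (hg1 : ∀ k a, g k a ≤ 1)
    (hfa : ∀ k, f k (a0 (ep k).1) = 1) (hga : ∀ k, g k (a0 (ep k).2) = 1)
    (hbad : ∑ k, chainBadBox P (ep k).1 (ep k).2 (x k) (f k) (g k) (m k) < P x0 a0) :
    ¬ Bilocal P := by
  rintro ⟨L, M, w, Q, R, hM, hw, hw1, hQ, hR, hP⟩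
  set S : Fin L → (∀ i, X i) → (∀ i, A i) → ℝ := fun l x a =>
    Q l (fun j => x j.1) (fun j => a j.1) * R l (fun j => x j.1) (fun j => a j.1) with hS
  have hS0 : ∀ l x a, 0 ≤ S l x a := fun l x a =>
    mul_nonneg ((hQ l).1.1 _ _) ((hR l).1.1 _ _)
  have hPS : ∀ x a, P x a = ∑ l, w l * S l x a := by
    intro x a
    rw [hP]
    exact Finset.sum_congr rfl fun l _ => mul_assoc _ _ _
  have hmarg : ∀ i j x (f : A i → ℝ) (g : A j → ℝ),
      marg P i j x f g = ∑ l, w l * marg (S l) i j x f g := by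
    intro i j x f g
    simp only [marg, hPS, Finset.mul_sum]
    rw [Finset.sum_comm]
    exact Finset.sum_congr rfl fun l _ => Finset.sum_congr rfl fun a _ => by ring
  have hbadl : ∀ k, chainBadBox P (ep k).1 (ep k).2 (x k) (f k) (g k) (m k) =
      ∑ l, w l * chainBadBox (S l) (ep k).1 (ep k).2 (x k) (f k) (g k) (m k) := by
    intro k
    simp only [chainBadBox, hmarg, mul_add, Finset.sum_add_distrib, Finset.mul_sum]
    congr 1
    congr 1 <;> rw [Finset.sum_comm]
  have key : ∀ l, S l x0 a0 ≤
      ∑ k, chainBadBox (S l) (ep k).1 (ep k).2 (x k) (f k) (g k) (m k) := by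
    intro l
    obtain ⟨k, hk⟩ := hcut (M l) (hM l).1 (hM l).2
    have h1 : S l x0 a0 ≤ chainBadBox (S l) (ep k).1 (ep k).2 (x k) (f k) (g k) (m k) := by
      rw [← hx0 k]
      rcases hk with ⟨hi, hj⟩ | ⟨hj, hi⟩
      · obtain ⟨q, r, hq0, hq1, hr0, hr1, H⟩ := product_marginal (M l) (Q l) (R l) (hQ l).1 (hQ l).2
          (hR l).1 (hR l).2 x0 _ _ hi hj
        exact chain_of_product (S l) (hS0 l) _ _ (x k) (f k) (g k) (hf k) (hg k) (hf1 k) (hg1 k)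
          (m k) (hxi k) (hxj k) a0 (hfa k) (hga k) q r hq0 hq1 hr0 hr1 H
      · obtain ⟨r, q, hr0, hr1, hq0, hq1, H⟩ := product_marginal (M l) (Q l) (R l) (hQ l).1 (hQ l).2
          (hR l).1 (hR l).2 x0 _ _ hj hi
        refine chain_of_product (S l) (hS0 l) _ _ (x k) (f k) (g k) (hf k) (hg k) (hf1 k) (hg1 k)
          (m k) (hxi k) (hxj k) a0 (hfa k) (hga k) q r hq0 hq1 hr0 hr1 ?_
        intro y f' g'
        rw [mul_comm, ← H y g' f', marg]
        exact Finset.sum_congr rfl fun a _ => by rw [mul_comm (f' _)]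
    refine h1.trans ?_
    exact Finset.single_le_sum (f := fun k => chainBadBox (S l) (ep k).1 (ep k).2 (x k) (f k) (g k) (m k))
      (fun k _ => chainBadBox_nonneg (S l) (hS0 l) _ _ _ _ _ (hf k) (hg k) (hf1 k) (hg1 k) _)
      (Finset.mem_univ k)
  have h2 : P x0 a0 ≤ ∑ k, chainBadBox P (ep k).1 (ep k).2 (x k) (f k) (g k) (m k) := by
    rw [hPS]
    simp only [hbadl]
    rw [Finset.sum_comm]
    refine Finset.sum_le_sum fun l _ => ?_
    rw [← Finset.mul_sum]
    exact mul_le_mul_of_nonneg_left (key l) (hw l)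
  linarith

lemma exists_cut {n K : ℕ} (ep : Fin K → Fin n × Fin n)
    (hconn : (SimpleGraph.fromRel fun i j => ∃ k, ep k = (i, j)).Connected)
    (M : Finset (Fin n)) (h1 : M.Nonempty) (h2 : M ≠ univ) :
    ∃ k, ((ep k).1 ∈ M ∧ (ep k).2 ∉ M) ∨ ((ep k).2 ∈ M ∧ (ep k).1 ∉ M) := by
  obtain ⟨u, hu⟩ := h1
  obtain ⟨v, hv⟩ : ∃ v, v ∉ M := by
    by_contra hc
    push Not at hc
    exact h2 (Finset.eq_univ_iff_forall.2 hc)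
  obtain ⟨p⟩ := hconn.preconnected u v
  obtain ⟨d, -, hd1, hd2⟩ := p.exists_boundary_dart (M : Set (Fin n)) hu hv
  have := d.adj
  rw [SimpleGraph.fromRel_adj] at this
  rcases this.2 with ⟨k, hk⟩ | ⟨k, hk⟩
  · refine ⟨k, Or.inl ?_⟩
    rw [hk]; exact ⟨hd1, hd2⟩
  · refine ⟨k, Or.inr ?_⟩
    rw [hk]; exact ⟨hd1, hd2⟩

end BilocalAbstract

section Network

lemma prod_sum_fn {κ : Type*} [Fintype κ] [DecidableEq κ] {D : κ → Type*} [∀ k, Fintype (D k)]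
    {S : Type*} [CommSemiring S] (F : ∀ k, D k → S) :
    ∑ g : ∀ k, D k, ∏ k, F k (g k) = ∏ k, ∑ q, F k q := by
  rw [Finset.prod_univ_sum, Fintype.piFinset_univ]

/-- tensor product of a family of matrices -/
def piMat {κ : Type*} [Fintype κ] {D : κ → Type*} (M : ∀ k, Matrix (D k) (D k) ℂ) :
    Matrix (∀ k, D k) (∀ k, D k) ℂ :=
  Matrix.of fun g g' => ∏ k, M k (g k) (g' k)

lemma piMat_proj {κ : Type*} [Fintype κ] [DecidableEq κ] {D : κ → Type*} [∀ k, Fintype (D k)]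
    (M : ∀ k, Matrix (D k) (D k) ℂ) (h : ∀ k, IsProjM (M k)) : IsProjM (piMat M) := by
  constructor
  · ext g g'
    simp only [piMat, Matrix.conjTranspose_apply, Matrix.of_apply, star_prod]
    refine Finset.prod_congr rfl fun k _ => ?_
    conv_rhs => rw [← (h k).1]
    rfl
  · ext g g'
    simp only [piMat, Matrix.mul_apply, Matrix.of_apply, ← Finset.prod_mul_distrib]
    rw [prod_sum_fn (fun k q => M k (g k) q * M k q (g' k))]
    refine Finset.prod_congr rfl fun k _ => ?_
    conv_rhs => rw [← (h k).2]
    rfl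

lemma piMat_sum {κ : Type*} [Fintype κ] [DecidableEq κ] {D O : κ → Type*} [∀ k, Fintype (O k)]
    [∀ k, DecidableEq (D k)] [DecidableEq (∀ k, D k)]
    (M : ∀ k, O k → Matrix (D k) (D k) ℂ) (h : ∀ k, ∑ a, M k a = 1) :
    ∑ a : ∀ k, O k, piMat (fun k => M k (a k)) = 1 := by
  ext g g'
  rw [Matrix.sum_apply]
  simp only [piMat, Matrix.of_apply]
  rw [prod_sum_fn (fun k q => M k q (g k) (g' k))]
  simp only [← Matrix.sum_apply, h, Matrix.one_apply]
  by_cases hg : g = g'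
  · subst hg; simp
  · rw [if_neg hg]
    obtain ⟨k, hk⟩ := Function.ne_iff.1 hg
    exact Finset.prod_eq_zero (Finset.mem_univ k) (by simp [hk])

/-- two-outcome measurement associated to a projector -/
def outOp {D : Type*} [DecidableEq D] (A : Matrix D D ℂ) (o : Fin 2) : Matrix D D ℂ :=
  if o = 0 then A else 1 - A

lemma outOp_proj {D : Type*} [Fintype D] [DecidableEq D] {A : Matrix D D ℂ} (h : IsProjM A)
    (o : Fin 2) : IsProjM (outOp A o) := by
  unfold outOp
  split_ifs
  · exact h
  · exact h.compl

lemma outOp_sum {D : Type*} [Fintype D] [DecidableEq D] (A : Matrix D D ℂ) :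
    ∑ o, outOp A o = 1 := by
  simp [Fin.sum_univ_two, outOp]

variable {n K : ℕ} (ep : Fin K → Fin n × Fin n) {dL dR : Fin K → ℕ}

/-- The measurement operators of the parties. -/
def netE (A : ∀ k, ℕ → Matrix (Fin (dL k)) (Fin (dL k)) ℂ)
    (B : ∀ k, ℕ → Matrix (Fin (dR k)) (Fin (dR k)) ℂ) (m : Fin K → ℕ) (i : Fin n)
    (x : PartyIdx n K ep (fun k => m k + 1) (fun k => m k + 1) i)
    (a : PartyIdx n K ep (fun _ => 2) (fun _ => 2) i) :
    Matrix (PartyIdx n K ep dL dR i) (PartyIdx n K ep dL dR i) ℂ :=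
  Matrix.kroneckerMap (· * ·) (piMat fun k => outOp (A k.1 (x.1 k)) (a.1 k))
    (piMat fun k => outOp (B k.1 (x.2 k)) (a.2 k))

variable (A : ∀ k, ℕ → Matrix (Fin (dL k)) (Fin (dL k)) ℂ)
    (B : ∀ k, ℕ → Matrix (Fin (dR k)) (Fin (dR k)) ℂ) (m : Fin K → ℕ)

lemma netE_psd (hA : ∀ k j, IsProjM (A k j)) (hB : ∀ k j, IsProjM (B k j)) (i : Fin n)
    (x : PartyIdx n K ep (fun k => m k + 1) (fun k => m k + 1) i)
    (a : PartyIdx n K ep (fun _ => 2) (fun _ => 2) i) :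
    (netE ep A B m i x a).PosSemidef :=
  Matrix.PosSemidef.kronecker (piMat_proj _ fun k => outOp_proj (hA _ _) _).posSemidef
    (piMat_proj _ fun k => outOp_proj (hB _ _) _).posSemidef

lemma netE_sum (i : Fin n)
    (x : PartyIdx n K ep (fun k => m k + 1) (fun k => m k + 1) i) :
    ∑ a, netE ep A B m i x a = 1 := by
  have h1 := piMat_sum (fun (k : {k : Fin K // (ep k).1 = i}) o => outOp (A k.1 (x.1 k)) o)
    (fun k => outOp_sum _)
  have h2 := piMat_sum (fun (k : {k : Fin K // (ep k).2 = i}) o => outOp (B k.1 (x.2 k)) o)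
    (fun k => outOp_sum _)
  ext g g'
  have h1' := congrFun (congrFun h1 g.1) g'.1
  have h2' := congrFun (congrFun h2 g.2) g'.2
  rw [Matrix.sum_apply] at h1' h2' ⊢
  simp only [netE, Matrix.kroneckerMap_apply]
  rw [Fintype.sum_prod_type]
  simp only [← Finset.mul_sum, ← Finset.sum_mul]
  rw [h1', h2']
  simp only [Matrix.one_apply, Prod.ext_iff]
  split_ifs <;> simp_all

/-- Global indices correspond to families of local indices. -/
def netEquiv (dL dR : Fin K → ℕ) : NetIdx K dL dR ≃ ∀ i, PartyIdx n K ep dL dR i where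
  toFun g i := partyProj ep i g
  invFun f k := ((f (ep k).1).1 ⟨k, rfl⟩, (f (ep k).2).2 ⟨k, rfl⟩)
  left_inv g := by ext k <;> rfl
  right_inv f := by
    funext i
    refine Prod.ext ?_ ?_
    · funext ⟨k, hk⟩; subst hk; rfl
    · funext ⟨k, hk⟩; subst hk; rfl

lemma netE_prod (X : NetIdx K (fun k => m k + 1) (fun k => m k + 1))
    (a : NetIdx K (fun _ => 2) (fun _ => 2)) (g g' : NetIdx K dL dR) :
    ∏ i, netE ep A B m i (partyProj ep i X) (partyProj ep i a) (partyProj ep i g)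
      (partyProj ep i g') =
    ∏ k, (outOp (A k (X k).1) (a k).1 (g k).1 (g' k).1 *
      outOp (B k (X k).2) (a k).2 (g k).2 (g' k).2) := by
  simp only [netE, Matrix.kroneckerMap_apply, piMat, Matrix.of_apply, partyProj,
    Finset.prod_mul_distrib]
  congr 1
  · exact Fintype.prod_fiberwise (fun k => (ep k).1)
      (fun k => outOp (A k (X k).1) (a k).1 (g k).1 (g' k).1)
  · exact Fintype.prod_fiberwise (fun k => (ep k).2)
      (fun k => outOp (B k (X k).2) (a k).2 (g k).2 (g' k).2)

/-- edge probabilities -/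
def edgeP (ψ : (k : Fin K) → Fin (dL k) × Fin (dR k) → ℂ) (k : Fin K) (s t : ℕ)
    (o : Fin 2 × Fin 2) : ℝ :=
  (edgeVal (outOp (A k s) o.1) (outOp (B k t) o.2) (ψ k)).re

variable (ψ : (k : Fin K) → Fin (dL k) × Fin (dR k) → ℂ)

lemma edgeP_ofReal (hA : ∀ k j, IsProjM (A k j)) (hB : ∀ k j, IsProjM (B k j)) (k : Fin K)
    (s t : ℕ) (o : Fin 2 × Fin 2) :
    edgeVal (outOp (A k s) o.1) (outOp (B k t) o.2) (ψ k) = (edgeP A B ψ k s t o : ℂ) := by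
  have h := edgeVal_nonneg (outOp_proj (hA k s) o.1).posSemidef
    (outOp_proj (hB k t) o.2).posSemidef (ψ k)
  have h2 := (Complex.nonneg_iff.1 h).2
  apply Complex.ext
  · rfl
  · rw [← h2]; simp

lemma edgeP_sum (hunit : ∀ k, UnitVec (ψ k)) (k : Fin K) (s t : ℕ) :
    ∑ o, edgeP A B ψ k s t o = 1 := by
  have h := edgeVal_one_one (ψ k) (hunit k)
  rw [Fintype.sum_prod_type]
  simp only [Fin.sum_univ_two, edgeP, outOp]
  simp [edgeVal_sub_left, edgeVal_sub_right, h]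

lemma net_box (hA : ∀ k j, IsProjM (A k j)) (hB : ∀ k j, IsProjM (B k j))
    (X : NetIdx K (fun k => m k + 1) (fun k => m k + 1))
    (a : NetIdx K (fun _ => 2) (fun _ => 2)) :
    (∑ g : NetIdx K dL dR, ∑ g' : NetIdx K dL dR,
      (∏ i, netE ep A B m i (partyProj ep i X) (partyProj ep i a) (partyProj ep i g)
        (partyProj ep i g')) *
      ((∏ k, ψ k (g' k)) * star (∏ k, ψ k (g k)))).re =
    ∏ k, edgeP A B ψ k (X k).1 (X k).2 (a k) := by
  have : ∑ g : NetIdx K dL dR, ∑ g' : NetIdx K dL dR,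
      (∏ i, netE ep A B m i (partyProj ep i X) (partyProj ep i a) (partyProj ep i g)
        (partyProj ep i g')) *
      ((∏ k, ψ k (g' k)) * star (∏ k, ψ k (g k))) =
      ((∏ k, edgeP A B ψ k (X k).1 (X k).2 (a k) : ℝ) : ℂ) := by
    simp only [netE_prod, star_prod, ← Finset.prod_mul_distrib]
    push_cast
    simp only [← edgeP_ofReal A B ψ hA hB, edgeVal]
    rw [← prod_sum_fn (fun k q => ∑ q', outOp (A k (X k).1) (a k).1 q.1 q'.1 *
      outOp (B k (X k).2) (a k).2 q.2 q'.2 * (ψ k q' * star (ψ k q)))]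
    refine Finset.sum_congr rfl fun g _ => ?_
    rw [← prod_sum_fn (fun k q' => outOp (A k (X k).1) (a k).1 (g k).1 q'.1 *
      outOp (B k (X k).2) (a k).2 (g k).2 q'.2 * (ψ k q' * star (ψ k (g k))))]
  rw [this, Complex.ofReal_re]

/-- marginal of a product distribution -/
lemma prod_marginal {κ O : Type*} [Fintype κ] [DecidableEq κ] [Fintype O] [DecidableEq O]
    (F : κ → O → ℝ) (hF : ∀ k, ∑ o, F k o = 1) (k : κ) (h : O → ℝ) :
    ∑ a : κ → O, h (a k) * ∏ k', F k' (a k') = ∑ o, h o * F k o := by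
  have h1 : ∀ a : κ → O, h (a k) * ∏ k', F k' (a k') =
      ∏ k', (if k' = k then h (a k') * F k' (a k') else F k' (a k')) := by
    intro a
    rw [← Finset.mul_prod_erase univ _ (Finset.mem_univ k),
      ← Finset.mul_prod_erase univ (fun k' => if k' = k then _ else _) (Finset.mem_univ k),
      if_pos rfl, mul_assoc]
    congr 2
    refine Finset.prod_congr rfl fun k' hk' => ?_
    rw [if_neg (Finset.ne_of_mem_erase hk')]
  simp only [h1]
  rw [prod_sum_fn (fun k' o => if k' = k then h o * F k' o else F k' o),
    Finset.prod_eq_single k]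
  · simp
  · intro k' _ hk'
    simp [hk', hF]
  · simp

end Network

/-- **GMNL is intrinsic to quantum networks.** Any connected network of bipartite pure
entangled states is genuinely multipartite nonlocal: there are local POVMs (each party
measuring its whole system, with finitely many inputs and outputs) whose resulting
correlations are not bilocal. -/
theorem connected_network_of_pure_entanglement_is_GMNL
    (n : ℕ) (hn : 2 ≤ n) (K : ℕ)
    (ep : Fin K → Fin n × Fin n) (hep : ∀ k, (ep k).1 ≠ (ep k).2)
    (hconn : (SimpleGraph.fromRel fun i j => ∃ k, ep k = (i, j)).Connected)
    (dL dR : Fin K → ℕ)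
    (ψ : (k : Fin K) → Fin (dL k) × Fin (dR k) → ℂ)
    (hunit : ∀ k, UnitVec (ψ k))
    (hent : ∀ k, ¬ ∃ (α : Fin (dL k) → ℂ) (β : Fin (dR k) → ℂ),
      ∀ q : Fin (dL k) × Fin (dR k), ψ k q = α q.1 * β q.2) :
    ∃ (mX mA : Fin n → ℕ)
      (E : (i : Fin n) → Fin (mX i) → Fin (mA i) →
        Matrix (PartyIdx n K ep dL dR i) (PartyIdx n K ep dL dR i) ℂ),
      (∀ i x a, (E i x a).PosSemidef) ∧
      (∀ i x, ∑ a, E i x a = 1) ∧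
      ¬ Bilocal (fun (x : ∀ i, Fin (mX i)) (a : ∀ i, Fin (mA i)) =>
        (∑ g : NetIdx K dL dR, ∑ g' : NetIdx K dL dR,
          (∏ i, E i (x i) (a i) (partyProj ep i g) (partyProj ep i g')) *
          ((∏ k, ψ k (g' k)) * star (∏ k, ψ k (g k)))).re) := by
  choose p hp H using fun k => edge_concrete (ψ k) (hent k)
  have hPi : 0 < ∏ k, p k := Finset.prod_pos fun k _ => hp k
  have hε : 0 < (∏ k, p k) / ((K : ℝ) + 1) := by positivity
  choose m A B hA hB h0 hbad using fun k => H k _ hε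
  let dX : ∀ i, Fin (Fintype.card (PartyIdx n K ep (fun k => m k + 1) (fun k => m k + 1) i)) ≃
    PartyIdx n K ep (fun k => m k + 1) (fun k => m k + 1) i := fun i => (Fintype.equivFin _).symm
  let dA : ∀ i, Fin (Fintype.card (PartyIdx n K ep (fun _ => 2) (fun _ => 2) i)) ≃
    PartyIdx n K ep (fun _ => 2) (fun _ => 2) i := fun i => (Fintype.equivFin _).symm
  refine ⟨_, _, fun i x a => netE ep A B m i (dX i x) (dA i a),
    fun i x a => netE_psd ep A B m hA hB i _ _, fun i x => ?_, ?_⟩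
  · rw [← netE_sum ep A B m i (dX i x)]
    exact Equiv.sum_comp (dA i) (fun a => netE ep A B m i (dX i x) a)
  set P := (fun (x : ∀ i, Fin (Fintype.card
        (PartyIdx n K ep (fun k => m k + 1) (fun k => m k + 1) i)))
      (a : ∀ i, Fin (Fintype.card (PartyIdx n K ep (fun _ => 2) (fun _ => 2) i))) =>
        (∑ g : NetIdx K dL dR, ∑ g' : NetIdx K dL dR,
          (∏ i, netE ep A B m i (dX i (x i)) (dA i (a i)) (partyProj ep i g) (partyProj ep i g')) *
          ((∏ k, ψ k (g' k)) * star (∏ k, ψ k (g k)))).re) with hPdef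
  let zX : NetIdx K (fun k => m k + 1) (fun k => m k + 1) := fun _ => (0, 0)
  let zA : NetIdx K (fun _ => 2) (fun _ => 2) := fun _ => (0, 0)
  let cX : Fin K → ℕ → ℕ → NetIdx K (fun k => m k + 1) (fun k => m k + 1) := fun k s t =>
    Function.update zX k (Fin.ofNat (m k + 1) s, Fin.ofNat (m k + 1) t)
  let xx : Fin K → ℕ → ℕ → ∀ i, Fin (Fintype.card
        (PartyIdx n K ep (fun k => m k + 1) (fun k => m k + 1) i)) :=
    fun k s t i => (dX i).symm (partyProj ep i (cX k s t))
  let F : Fin 2 → ℝ := fun o => if o = 0 then 1 else 0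
  have hF0 : ∀ o, 0 ≤ F o := fun o => by dsimp only [F]; split_ifs <;> norm_num
  have hF1 : ∀ o, F o ≤ 1 := fun o => by dsimp only [F]; split_ifs <;> norm_num
  -- value of the box
  have hPval : ∀ (X : NetIdx K (fun k => m k + 1) (fun k => m k + 1))
      (a : NetIdx K (fun _ => 2) (fun _ => 2)),
      P (fun i => (dX i).symm (partyProj ep i X)) (fun i => (dA i).symm (partyProj ep i a)) =
      ∏ k, edgeP A B ψ k (X k).1 (X k).2 (a k) := by
    intro X a
    rw [← net_box ep A B m ψ hA hB X a]
    simp only [hPdef, Equiv.apply_symm_apply]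
  have hmarg : ∀ k s t, s ≤ m k → t ≤ m k → ∀ f g : Fin 2 → ℝ,
      marg P (ep k).1 (ep k).2 (xx k s t) (fun a => f ((dA _ a).1 ⟨k, rfl⟩))
        (fun a => g ((dA _ a).2 ⟨k, rfl⟩)) = ∑ o, f o.1 * g o.2 * edgeP A B ψ k s t o := by
    intro k s t hs ht f g
    have e1 := prod_marginal (fun k' => edgeP A B ψ k' (cX k s t k').1 (cX k s t k').2)
      (fun k' => edgeP_sum A B ψ hunit k' _ _) k (fun o => f o.1 * g o.2)
    have e2 : cX k s t k = (Fin.ofNat (m k + 1) s, Fin.ofNat (m k + 1) t) := by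
      simp [cX]
    have e3 : ((Fin.ofNat (m k + 1) s : Fin (m k + 1)) : ℕ) = s := by
      simp [Fin.ofNat, Nat.mod_eq_of_lt (Nat.lt_succ_of_le hs)]
    have e4 : ((Fin.ofNat (m k + 1) t : Fin (m k + 1)) : ℕ) = t := by
      simp [Fin.ofNat, Nat.mod_eq_of_lt (Nat.lt_succ_of_le ht)]
    rw [e2] at e1
    simp only [e3, e4] at e1
    rw [← e1, marg]
    symm
    refine Fintype.sum_equiv ((netEquiv ep (fun _ => 2) (fun _ => 2)).trans
      (Equiv.piCongrRight fun i => (dA i).symm)) _ _ fun a => ?_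
    have e5 := hPval (cX k s t) a
    have e6 : ((netEquiv ep (fun _ => 2) (fun _ => 2)).trans
      (Equiv.piCongrRight fun i => (dA i).symm)) a =
        (fun i => (dA i).symm (partyProj ep i a)) := rfl
    rw [e6, e5]
    simp only [Equiv.apply_symm_apply]
    rfl
  refine not_bilocal_abstract ep (exists_cut ep hconn) P m
    (fun i => (dX i).symm (partyProj ep i zX)) (fun i => (dA i).symm (partyProj ep i zA))
    xx ?_ ?_ ?_ (fun k a => F ((dA _ a).1 ⟨k, rfl⟩)) (fun k a => F ((dA _ a).2 ⟨k, rfl⟩))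
    (fun k a => hF0 _) (fun k a => hF0 _) (fun k a => hF1 _) (fun k a => hF1 _) ?_ ?_ ?_
  · intro k
    have : cX k 0 0 = zX := by
      funext k'
      by_cases hk : k' = k
      · subst hk; simp [cX, zX]
      · simp [cX, hk]
    simp only [xx, this]
  · intro k s t
    dsimp only [xx]
    congr 1
    refine Prod.ext ?_ ?_
    · funext ⟨k', hk'⟩
      by_cases hk : k' = k
      · subst hk; simp [partyProj, cX]
      · simp [partyProj, cX, hk]
    · funext ⟨k', hk'⟩
      have hk : k' ≠ k := by
        rintro rfl; exact hep _ hk'.symm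
      simp [partyProj, cX, hk]
  · intro k s t
    dsimp only [xx]
    congr 1
    refine Prod.ext ?_ ?_
    · funext ⟨k', hk'⟩
      have hk : k' ≠ k := by
        rintro rfl; exact hep _ hk'
      simp [partyProj, cX, hk]
    · funext ⟨k', hk'⟩
      by_cases hk : k' = k
      · subst hk; simp [partyProj, cX]
      · simp [partyProj, cX, hk]
  · intro k; simp [F, partyProj, zA]
  · intro k; simp [F, partyProj, zA]
  · have hb : ∀ k, chainBadBox P (ep k).1 (ep k).2 (xx k) (fun a => F ((dA _ a).1 ⟨k, rfl⟩))
        (fun a => F ((dA _ a).2 ⟨k, rfl⟩)) (m k) = edgeBad (ψ k) (m k) (A k) (B k) := by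
      intro k
      have m1 : ∀ s ∈ Finset.range (m k), marg P (ep k).1 (ep k).2 (xx k s (s+1))
          (fun a => F ((dA _ a).1 ⟨k, rfl⟩)) (1 - fun a => F ((dA _ a).2 ⟨k, rfl⟩)) =
          (edgeVal (A k s) (1 - B k (s+1)) (ψ k)).re := by
        intro s hs
        have hs' := Finset.mem_range.1 hs
        have := hmarg k s (s+1) hs'.le hs' F (1 - F)
        refine Eq.trans this ?_
        rw [Fintype.sum_prod_type]
        simp only [Fin.sum_univ_two]
        simp [F, edgeP, outOp]
      have m2 : ∀ s ∈ Finset.range (m k), marg P (ep k).1 (ep k).2 (xx k (s+1) (s+1))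
          (1 - fun a => F ((dA _ a).1 ⟨k, rfl⟩)) (fun a => F ((dA _ a).2 ⟨k, rfl⟩)) =
          (edgeVal (1 - A k (s+1)) (B k (s+1)) (ψ k)).re := by
        intro s hs
        have hs' := Finset.mem_range.1 hs
        have := hmarg k (s+1) (s+1) hs' hs' (1 - F) F
        refine Eq.trans this ?_
        rw [Fintype.sum_prod_type]
        simp only [Fin.sum_univ_two]
        simp [F, edgeP, outOp]
      have m3 : marg P (ep k).1 (ep k).2 (xx k (m k) 0)
          (fun a => F ((dA _ a).1 ⟨k, rfl⟩)) (fun a => F ((dA _ a).2 ⟨k, rfl⟩)) =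
          (edgeVal (A k (m k)) (B k 0) (ψ k)).re := by
        have := hmarg k (m k) 0 le_rfl (Nat.zero_le _) F F
        refine Eq.trans this ?_
        rw [Fintype.sum_prod_type]
        simp only [Fin.sum_univ_two]
        simp [F, edgeP, outOp]
      rw [chainBadBox, edgeBad, Finset.sum_congr rfl m1, Finset.sum_congr rfl m2, m3]
    simp only [hb]
    rw [hPval]
    have l1 : ∑ k, edgeBad (ψ k) (m k) (A k) (B k) ≤ K * ((∏ k, p k) / ((K : ℝ) + 1)) := by
      refine (Finset.sum_le_sum fun k _ => hbad k).trans ?_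
      simp
    have l2 : K * ((∏ k, p k) / ((K : ℝ) + 1)) < ∏ k, p k := by
      rw [mul_div_assoc', div_lt_iff₀ (by positivity)]
      linarith
    have l3 : ∏ k, p k ≤ ∏ k, edgeP A B ψ k (zX k).1 (zX k).2 (zA k) := by
      refine Finset.prod_le_prod (fun k _ => (hp k).le) fun k _ => ?_
      simpa [edgeP, outOp, zX, zA] using h0 k
    linarith
end
end

section
/- Biseparability of the Lambda network of isotropic states: let d ≥ 2 and p ∈ [0,1] with p ≤ ((1+√2)d − 1)/(d² + 2d − 1). Then the state ρ_p ⊗ ρ_p, where the first d-dimensional isotropic state is shared between subsystems A₁ and B and the second between subsystems A₂ and C, regarded as a tripartite state of parties A (holding A₁ and A₂), B, and C, is biseparable. -/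
open Matrix Finset
open scoped ComplexOrder

attribute [local instance] Classical.propDecidable

noncomputable section

/-- The maximally entangled vector `(1/√d) ∑ᵢ |ii⟩` on `ℂ^d ⊗ ℂ^d`. -/
def maxEntVec (d : ℕ) : Fin d × Fin d → ℂ :=
  fun q => if q.1 = q.2 then (((Real.sqrt d)⁻¹ : ℝ) : ℂ) else 0

/-- The `d`-dimensional isotropic state with visibility `p`:
`ρ_p = p·φ_d⁺ + (1-p)·𝟙/d²`. -/
def isoState (d : ℕ) (p : ℝ) : Matrix (Fin d × Fin d) (Fin d × Fin d) ℂ :=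
  (p : ℂ) • vecProj (maxEntVec d) +
    ((((1 - p) / (d ^ 2 : ℝ)) : ℝ) : ℂ) •
      (1 : Matrix (Fin d × Fin d) (Fin d × Fin d) ℂ)

/-- A vector on a tripartite system `α × β × γ` is product across one of the three
bipartitions of the parties. -/
def ProdAcross3 {α β γ : Type*} (v : α × β × γ → ℂ) : Prop :=
  (∃ (f : α → ℂ) (g : β × γ → ℂ), ∀ q, v q = f q.1 * g q.2) ∨
  (∃ (f : β → ℂ) (g : α × γ → ℂ), ∀ q, v q = f q.2.1 * g (q.1, q.2.2)) ∨
  (∃ (f : γ → ℂ) (g : α × β → ℂ), ∀ q, v q = f q.2.2 * g (q.1, q.2.1))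

/-- Biseparability of a tripartite state with parties `α`, `β`, `γ`. -/
def Bisep3 {α β γ : Type*} [Fintype α] [Fintype β] [Fintype γ]
    (ρ : Matrix (α × β × γ) (α × β × γ) ℂ) : Prop :=
  ∃ (m : ℕ) (w : Fin m → ℝ) (u : Fin m → α × β × γ → ℂ),
    (∀ k, 0 ≤ w k) ∧ (∑ k, w k = 1) ∧
    (∀ k, UnitVec (u k) ∧ ProdAcross3 (u k)) ∧
    ρ = ∑ k, (w k : ℂ) • vecProj (u k)

/-- The Lambda network state: an isotropic state `ρ_{p₁}` on subsystems `A₁B` tensored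
with an isotropic state `ρ_{p₂}` on subsystems `A₂C`, with indices grouped by party as
`(A₁ × A₂) × B × C`. -/
def lambdaNet (d : ℕ) (p₁ p₂ : ℝ) :
    Matrix ((Fin d × Fin d) × Fin d × Fin d) ((Fin d × Fin d) × Fin d × Fin d) ℂ :=
  Matrix.of fun x y =>
    isoState d p₁ (x.1.1, x.2.1) (y.1.1, y.2.1) *
    isoState d p₂ (x.1.2, x.2.2) (y.1.2, y.2.2)

/-- Kronecker delta. -/
def dl {X : Type*} (a b : X) : ℂ := if a = b then 1 else 0

lemma star_dl {X : Type*} (a b : X) : star (dl a b) = dl a b := by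
  unfold dl; split_ifs <;> simp

/-- Every phase average needed: a fourth-moment identity over third roots of unity. -/
lemma phase_sum {D : Type*} [Fintype D] (i j k l : D) :
    ∑ z : D → ZMod 3, (ZMod.stdAddChar (z i - z j - z k + z l) : ℂ) =
      (Fintype.card (D → ZMod 3) : ℂ) *
        (dl i j * dl k l + dl i k * dl j l - dl i j * dl i k * dl i l) := by
  let F : (D → ZMod 3) →+ ZMod 3 :=
    Pi.evalAddMonoidHom (fun _ : D => ZMod 3) i - Pi.evalAddMonoidHom (fun _ : D => ZMod 3) j - Pi.evalAddMonoidHom (fun _ : D => ZMod 3) k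
      + Pi.evalAddMonoidHom (fun _ : D => ZMod 3) l
  have h := AddChar.sum_eq_ite ((ZMod.stdAddChar (N := 3)).compAddMonoidHom F)
  have hF : ∀ z, F z = z i - z j - z k + z l := fun z => by simp [F]
  simp only [AddChar.compAddMonoidHom_apply, hF] at h
  rw [h]
  by_cases hc : (i = j ∧ k = l) ∨ (i = k ∧ j = l)
  · rw [if_pos]
    · rcases hc with ⟨rfl, rfl⟩ | ⟨rfl, rfl⟩
      · by_cases hik : i = k <;> simp [dl, hik]
      · by_cases hik : i = j <;> simp [dl, hik]
    · ext z
      simp only [AddChar.compAddMonoidHom_apply, hF]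
      rcases hc with ⟨rfl, rfl⟩ | ⟨rfl, rfl⟩ <;> simp
  · rw [if_neg]
    · have : dl i j * dl k l + dl i k * dl j l - dl i j * dl i k * dl i l = 0 := by
        unfold dl
        split_ifs <;> simp_all
      rw [this]; simp
    · intro h0
      apply hc
      have key : ∀ z : D → ZMod 3, z i - z j - z k + z l = 0 := by
        intro z
        have h1 : (ZMod.stdAddChar (z i - z j - z k + z l) : ℂ) = 1 := by
          have := DFunLike.congr_fun h0 z
          simpa only [AddChar.compAddMonoidHom_apply, hF, AddChar.zero_apply] using this
        apply ZMod.injective_stdAddChar (N := 3)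
        rw [h1, AddChar.map_zero_eq_one]
      have ki := key (fun x => if x = i then 1 else 0)
      have kl := key (fun x => if x = l then 1 else 0)
      have t1 : (1 + 1 : ZMod 3) ≠ 0 := by decide
      have t2 : (1 - 1 - 1 : ZMod 3) ≠ 0 := by decide
      have t3 : (1 : ZMod 3) ≠ 0 := by decide
      have t4 : (1 - 1 + 1 : ZMod 3) ≠ 0 := by decide
      have t5 : (1 - 1 - 1 + 1 : ZMod 3) = 0 := by decide
      by_cases hij : j = i <;> by_cases hik : k = i <;> by_cases hil : l = i <;>
        by_cases hjl : j = l <;> by_cases hkl : k = l <;> simp_all <;> grind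

/-- `|Ω⟩⟨Ω| + 1` is a finite sum of projectors on product vectors. -/
lemma sep_family (D : Type) [Fintype D] :
    ∃ (ι : Type) (_ : Fintype ι) (f g : ι → D → ℂ), ∀ i j k l : D,
      ∑ t, (f t i * g t j) * star (f t k * g t l) = dl i j * dl k l + dl i k * dl j l := by
  set N : ℝ := (Fintype.card (D → ZMod 3) : ℝ) with hN
  have hN0 : 0 < N := by
    rw [hN]; exact_mod_cast Fintype.card_pos
  refine ⟨(D → ZMod 3) ⊕ D, inferInstance,
    Sum.elim (fun z i => (((Real.sqrt N)⁻¹ : ℝ) : ℂ) * ZMod.stdAddChar (z i)) (fun a i => dl i a),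
    Sum.elim (fun z i => ZMod.stdAddChar (-z i)) (fun a i => dl i a), fun i j k l => ?_⟩
  rw [Fintype.sum_sum_type]
  simp only [Sum.elim_inl, Sum.elim_inr]
  have hs : (((Real.sqrt N)⁻¹ : ℝ) : ℂ) * (((Real.sqrt N)⁻¹ : ℝ) : ℂ) = ((N⁻¹ : ℝ) : ℂ) := by
    rw [← Complex.ofReal_mul, ← mul_inv, Real.mul_self_sqrt hN0.le]
  have h1 : ∀ z : D → ZMod 3,
      (((Real.sqrt N)⁻¹ : ℝ) : ℂ) * ZMod.stdAddChar (z i) * ZMod.stdAddChar (-z j) *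
        star ((((Real.sqrt N)⁻¹ : ℝ) : ℂ) * ZMod.stdAddChar (z k) * ZMod.stdAddChar (-z l)) =
      ((N⁻¹ : ℝ) : ℂ) * ZMod.stdAddChar (z i - z j - z k + z l) := by
    intro z
    have e : z i - z j - z k + z l = z i + -z j + -z k + -(-z l) := by ring
    rw [e, AddChar.map_add_eq_mul, AddChar.map_add_eq_mul, AddChar.map_add_eq_mul,
      AddChar.map_neg_eq_conj _ (z k), AddChar.map_neg_eq_conj _ (-z l), ← hs]
    simp only [star_mul', Complex.star_def, Complex.conj_ofReal]
    ring
  rw [Finset.sum_congr rfl (fun z _ => h1 z), ← Finset.mul_sum, phase_sum]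
  have h2 : ∑ a, dl i a * dl j a * star (dl k a * dl l a) = dl i j * dl i k * dl i l := by
    simp only [star_mul', star_dl]
    rw [Finset.sum_eq_single i]
    · unfold dl; simp only [eq_comm]; split_ifs <;> simp_all
    · intro b _ hb; simp [dl, hb.symm]
    · simp
  rw [h2]
  have h3 : ((N⁻¹ : ℝ) : ℂ) * (Fintype.card (D → ZMod 3) : ℂ) = 1 := by
    have : (Fintype.card (D → ZMod 3) : ℂ) = ((N : ℝ) : ℂ) := by rw [hN]; simp
    rw [this, ← Complex.ofReal_mul, inv_mul_cancel₀ hN0.ne']; simp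
  rw [← mul_assoc, h3]
  ring

/-- The cone of unnormalised biseparable operators. -/
def bcone (α β γ : Type) [Fintype α] [Fintype β] [Fintype γ] :
    AddSubmonoid (Matrix (α × β × γ) (α × β × γ) ℂ) :=
  AddSubmonoid.closure {M | ∃ u : α × β × γ → ℂ, ProdAcross3 u ∧ M = vecProj u}

section cone
variable {α β γ : Type} [Fintype α] [Fintype β] [Fintype γ]

lemma ProdAcross3.smul {u : α × β × γ → ℂ} (h : ProdAcross3 u) (c : ℂ) :
    ProdAcross3 (fun q => c * u q) := by
  rcases h with ⟨f, g, h⟩ | ⟨f, g, h⟩ | ⟨f, g, h⟩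
  · exact Or.inl ⟨fun a => c * f a, g, fun q => by simp only [h]; ring⟩
  · exact Or.inr (Or.inl ⟨fun a => c * f a, g, fun q => by simp only [h]; ring⟩)
  · exact Or.inr (Or.inr ⟨fun a => c * f a, g, fun q => by simp only [h]; ring⟩)

lemma vecProj_smul {D : Type*} [Fintype D] (c : ℝ) (u : D → ℂ) :
    vecProj (fun q => (c : ℂ) * u q) = ((c * c : ℝ) : ℂ) • vecProj u := by
  ext i j
  simp only [vecProj, Matrix.of_apply, Matrix.smul_apply, smul_eq_mul, star_mul',
    Complex.star_def, Complex.conj_ofReal, Complex.ofReal_mul]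
  ring

lemma bcone_smul {M : Matrix (α × β × γ) (α × β × γ) ℂ} (hM : M ∈ bcone α β γ)
    (c : ℝ) (hc : 0 ≤ c) : (c : ℂ) • M ∈ bcone α β γ := by
  induction hM using AddSubmonoid.closure_induction with
  | mem x hx =>
    obtain ⟨u, hu, rfl⟩ := hx
    apply AddSubmonoid.subset_closure
    refine ⟨_, hu.smul ((Real.sqrt c : ℝ) : ℂ), ?_⟩
    rw [vecProj_smul, Real.mul_self_sqrt hc]
  | zero => rw [smul_zero]; exact zero_mem _
  | add x y _ _ hx hy => rw [smul_add]; exact add_mem hx hy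

lemma bcone_sum {ι : Type} [Fintype ι] (u : ι → α × β × γ → ℂ) (hu : ∀ t, ProdAcross3 (u t))
    (M : Matrix (α × β × γ) (α × β × γ) ℂ) (hM : ∀ x y, M x y = ∑ t, u t x * star (u t y)) :
    M ∈ bcone α β γ := by
  have : M = ∑ t, vecProj (u t) := by
    ext x y
    rw [hM, Matrix.sum_apply]; rfl
  rw [this]
  exact sum_mem fun t _ => AddSubmonoid.subset_closure ⟨u t, hu t, rfl⟩

lemma bcone_decomp {M : Matrix (α × β × γ) (α × β × γ) ℂ} (hM : M ∈ bcone α β γ) :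
    ∃ (m : ℕ) (w : Fin m → ℝ) (u : Fin m → α × β × γ → ℂ),
    (∀ k, 0 ≤ w k) ∧ (∀ k, UnitVec (u k) ∧ ProdAcross3 (u k)) ∧
    M = ∑ k, (w k : ℂ) • vecProj (u k) := by
  induction hM using AddSubmonoid.closure_induction with
  | mem x hx =>
    obtain ⟨u, hu, rfl⟩ := hx
    set s : ℝ := ∑ i, Complex.normSq (u i) with hs
    have hs0 : 0 ≤ s := Finset.sum_nonneg fun i _ => Complex.normSq_nonneg _
    have hsc : ∑ i, star (u i) * u i = (s : ℂ) := by
      rw [hs, Complex.ofReal_sum]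
      refine Finset.sum_congr rfl fun i _ => ?_
      rw [Complex.normSq_eq_conj_mul_self]; rfl
    rcases hs0.eq_or_lt with h0 | h0
    · refine ⟨0, Fin.elim0, Fin.elim0, fun k => k.elim0, fun k => k.elim0, ?_⟩
      have : ∀ i, u i = 0 := by
        intro i
        have := (Finset.sum_eq_zero_iff_of_nonneg
          (fun i _ => Complex.normSq_nonneg (u i))).1 h0.symm i (Finset.mem_univ i)
        exact Complex.normSq_eq_zero.1 this
      ext i j
      simp [vecProj, this]
    · have hq : (Real.sqrt s)⁻¹ * (Real.sqrt s)⁻¹ = s⁻¹ := by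
        rw [← mul_inv, Real.mul_self_sqrt h0.le]
      refine ⟨1, fun _ => s, fun _ q => (((Real.sqrt s)⁻¹ : ℝ) : ℂ) * u q, fun _ => h0.le,
        fun _ => ⟨?_, hu.smul _⟩, ?_⟩
      · unfold UnitVec
        have : ∀ i, star ((((Real.sqrt s)⁻¹ : ℝ) : ℂ) * u i) * ((((Real.sqrt s)⁻¹ : ℝ) : ℂ) * u i)
            = ((s⁻¹ : ℝ) : ℂ) * (star (u i) * u i) := by
          intro i
          rw [← hq]
          simp only [star_mul', Complex.star_def, Complex.conj_ofReal, Complex.ofReal_mul]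
          ring
        rw [Finset.sum_congr rfl fun i _ => this i, ← Finset.mul_sum, hsc, ← Complex.ofReal_mul,
          inv_mul_cancel₀ h0.ne', Complex.ofReal_one]
      · simp only [Finset.univ_unique, Finset.sum_singleton]
        rw [vecProj_smul, hq, smul_smul, ← Complex.ofReal_mul, mul_inv_cancel₀ h0.ne',
          Complex.ofReal_one, one_smul]
  | zero => exact ⟨0, Fin.elim0, Fin.elim0, fun k => k.elim0, fun k => k.elim0, by simp⟩
  | add x y _ _ hx hy =>
    obtain ⟨m, w, u, h1, h2, h3⟩ := hx
    obtain ⟨m', w', u', h1', h2', h3'⟩ := hy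
    refine ⟨m + m', Fin.append w w', Fin.append u u', ?_, ?_, ?_⟩
    · intro k
      refine Fin.addCases (fun i => ?_) (fun i => ?_) k
      · simpa using h1 i
      · simpa using h1' i
    · intro k
      refine Fin.addCases (fun i => ?_) (fun i => ?_) k
      · simpa using h2 i
      · simpa using h2' i
    · rw [Fin.sum_univ_add, h3, h3']
      simp

lemma bisep_of_bcone {M : Matrix (α × β × γ) (α × β × γ) ℂ} (hM : M ∈ bcone α β γ)
    (ht : M.trace = 1) : Bisep3 M := by
  obtain ⟨m, w, u, h1, h2, h3⟩ := bcone_decomp hM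
  refine ⟨m, w, u, h1, ?_, h2, h3⟩
  have hv : ∀ k, (vecProj (u k)).trace = 1 := by
    intro k
    rw [← (h2 k).1]
    simp only [Matrix.trace, vecProj, Matrix.diag_apply, Matrix.of_apply, mul_comm]
  rw [h3, Matrix.trace_sum] at ht
  simp only [Matrix.trace_smul, hv, smul_eq_mul, mul_one] at ht
  exact_mod_cast ht

end cone

/-- Operators on the network with entries given by `F`. -/
abbrev NetMat (d : ℕ) :=
  Matrix ((Fin d × Fin d) × Fin d × Fin d) ((Fin d × Fin d) × Fin d × Fin d) ℂ

/-- unnormalised `|Ω⟩⟨Ω|` on `A₁B`. -/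
def E1 {d : ℕ} (x y : (Fin d × Fin d) × Fin d × Fin d) : ℂ := dl x.1.1 x.2.1 * dl y.1.1 y.2.1
/-- unnormalised `|Ω⟩⟨Ω|` on `A₂C`. -/
def E2 {d : ℕ} (x y : (Fin d × Fin d) × Fin d × Fin d) : ℂ := dl x.1.2 x.2.2 * dl y.1.2 y.2.2
/-- identity on `A₁B`. -/
def I1 {d : ℕ} (x y : (Fin d × Fin d) × Fin d × Fin d) : ℂ := dl x.1.1 y.1.1 * dl x.2.1 y.2.1
/-- identity on `A₂C`. -/
def I2 {d : ℕ} (x y : (Fin d × Fin d) × Fin d × Fin d) : ℂ := dl x.1.2 y.1.2 * dl x.2.2 y.2.2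

lemma dl_prod {X Y : Type*} (a b : X × Y) : dl a b = dl a.1 b.1 * dl a.2 b.2 := by
  unfold dl
  rcases a with ⟨a, a'⟩
  rcases b with ⟨b, b'⟩
  simp only [Prod.mk.injEq]
  split_ifs <;> simp_all

lemma dl_sum {X : Type*} [Fintype X] (a b : X) : ∑ t, dl a t * dl b t = dl a b := by
  rw [Finset.sum_eq_single b]
  · simp [dl]
  · intro c _ hc; simp [dl, hc.symm]
  · simp

lemma gen_A (d : ℕ) : (Matrix.of fun x y => E1 x y * E2 x y + I1 x y * I2 x y : NetMat d) ∈
    bcone (Fin d × Fin d) (Fin d) (Fin d) := by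
  obtain ⟨ι, _, f, g, h⟩ := sep_family (Fin d × Fin d)
  refine bcone_sum (fun t q => f t q.1 * g t q.2) (fun t => Or.inl ⟨f t, g t, fun q => rfl⟩) _ ?_
  intro x y
  rw [h]
  simp only [Matrix.of_apply, E1, E2, I1, I2, dl_prod x.1, dl_prod y.1, dl_prod x.2]
  ring

lemma gen_B (d : ℕ) : (Matrix.of fun x y => (E1 x y + I1 x y) * E2 x y : NetMat d) ∈
    bcone (Fin d × Fin d) (Fin d) (Fin d) := by
  obtain ⟨ι, _, f, g, h⟩ := sep_family (Fin d)
  refine bcone_sum (fun t q => g t q.2.1 * (f t q.1.1 * dl q.1.2 q.2.2))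
    (fun t => Or.inr (Or.inl ⟨g t, fun q => f t q.1.1 * dl q.1.2 q.2, fun q => rfl⟩)) _ ?_
  intro x y
  simp only [Matrix.of_apply, E1, E2, I1]
  rw [← h, Finset.sum_mul]
  refine Finset.sum_congr rfl fun t _ => ?_
  simp only [star_mul', star_dl]
  ring

lemma gen_C (d : ℕ) : (Matrix.of fun x y => (E2 x y + I2 x y) * E1 x y : NetMat d) ∈
    bcone (Fin d × Fin d) (Fin d) (Fin d) := by
  obtain ⟨ι, _, f, g, h⟩ := sep_family (Fin d)
  refine bcone_sum (fun t q => g t q.2.2 * (f t q.1.2 * dl q.1.1 q.2.1))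
    (fun t => Or.inr (Or.inr ⟨g t, fun q => f t q.1.2 * dl q.1.1 q.2, fun q => rfl⟩)) _ ?_
  intro x y
  simp only [Matrix.of_apply, E1, E2, I2]
  rw [← h, Finset.sum_mul]
  refine Finset.sum_congr rfl fun t _ => ?_
  simp only [star_mul', star_dl]
  ring

lemma dl_sum2 {X Y : Type*} [Fintype X] [Fintype Y] (a b : X) (c e : Y) (r : ℂ) :
    ∑ t : X × Y, r * ((dl a t.1 * dl b t.1) * (dl c t.2 * dl e t.2)) = r * (dl a b * dl c e) := by
  rw [← Finset.mul_sum, Fintype.sum_prod_type, ← dl_sum a b, ← dl_sum c e, Finset.sum_mul_sum]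

lemma gen_II (d : ℕ) : (Matrix.of fun x y => I1 x y * I2 x y : NetMat d) ∈
    bcone (Fin d × Fin d) (Fin d) (Fin d) := by
  refine bcone_sum (ι := (Fin d × Fin d) × (Fin d × Fin d)) (fun t q => dl q.1 t.1 * dl q.2 t.2)
    (fun t => Or.inl ⟨fun a => dl a t.1, fun a => dl a t.2, fun q => rfl⟩) _ ?_
  intro x y
  have := dl_sum2 x.1 y.1 x.2 y.2 1
  simp only [one_mul] at this
  have e : (Matrix.of fun x y => I1 x y * I2 x y : NetMat d) x y = dl x.1 y.1 * dl x.2 y.2 := by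
    simp only [Matrix.of_apply, I1, I2, dl_prod x.1 y.1, dl_prod x.2 y.2]
    ring
  rw [e, ← this]
  refine Finset.sum_congr rfl fun t _ => ?_
  simp only [star_mul', star_dl]
  ring

lemma gen_IE (d : ℕ) : (Matrix.of fun x y => I1 x y * E2 x y : NetMat d) ∈
    bcone (Fin d × Fin d) (Fin d) (Fin d) := by
  refine bcone_sum (ι := Fin d × Fin d)
    (fun t q => dl q.2.1 t.2 * (dl q.1.1 t.1 * dl q.1.2 q.2.2))
    (fun t => Or.inr (Or.inl ⟨fun a => dl a t.2, fun q => dl q.1.1 t.1 * dl q.1.2 q.2,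
      fun q => rfl⟩)) _ ?_
  intro x y
  have := dl_sum2 x.1.1 y.1.1 x.2.1 y.2.1 (E2 x y)
  simp only [Matrix.of_apply, I1]
  rw [mul_comm, ← this]
  refine Finset.sum_congr rfl fun t _ => ?_
  simp only [star_mul', star_dl, E2]
  ring

lemma gen_EI (d : ℕ) : (Matrix.of fun x y => I2 x y * E1 x y : NetMat d) ∈
    bcone (Fin d × Fin d) (Fin d) (Fin d) := by
  refine bcone_sum (ι := Fin d × Fin d)
    (fun t q => dl q.2.2 t.2 * (dl q.1.2 t.1 * dl q.1.1 q.2.1))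
    (fun t => Or.inr (Or.inr ⟨fun a => dl a t.2, fun q => dl q.1.2 t.1 * dl q.1.1 q.2,
      fun q => rfl⟩)) _ ?_
  intro x y
  have := dl_sum2 x.1.2 y.1.2 x.2.2 y.2.2 (E1 x y)
  simp only [Matrix.of_apply, I2]
  rw [mul_comm, ← this]
  refine Finset.sum_congr rfl fun t _ => ?_
  simp only [star_mul', star_dl, E1]
  ring

lemma isoState_apply (d : ℕ) (p : ℝ) (a b a' b' : Fin d) :
    isoState d p (a, b) (a', b') =
      ((p / d : ℝ) : ℂ) * (dl a b * dl a' b') +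
      (((1 - p) / (d ^ 2 : ℝ) : ℝ) : ℂ) * (dl a a' * dl b b') := by
  have hs : (((Real.sqrt d)⁻¹ : ℝ) : ℂ) * (((Real.sqrt d)⁻¹ : ℝ) : ℂ) = (((d : ℝ)⁻¹ : ℝ) : ℂ) := by
    rw [← Complex.ofReal_mul, ← mul_inv, Real.mul_self_sqrt (Nat.cast_nonneg d)]
  have hm : ∀ a b : Fin d, maxEntVec d (a, b) = (((Real.sqrt d)⁻¹ : ℝ) : ℂ) * dl a b := by
    intro a b
    by_cases h : a = b <;> simp [maxEntVec, dl, h]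
  have h1 : (1 : Matrix (Fin d × Fin d) (Fin d × Fin d) ℂ) (a, b) (a', b')
      = dl a a' * dl b b' := by
    rw [Matrix.one_apply]
    by_cases h : a = a' <;> by_cases h' : b = b' <;> simp [dl, h, h']
  simp only [isoState, Matrix.add_apply, Matrix.smul_apply, vecProj, Matrix.of_apply, hm, h1,
    smul_eq_mul, star_mul', star_dl]
  rw [Complex.star_def, Complex.conj_ofReal, div_eq_mul_inv p, Complex.ofReal_mul p, ← hs]
  ring

lemma isoState_trace (d : ℕ) (hd : 2 ≤ d) (p : ℝ) :
    ∑ a, ∑ b, isoState d p (a, b) (a, b) = 1 := by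
  have hd0 : (d : ℂ) ≠ 0 := by
    have : d ≠ 0 := by omega
    exact_mod_cast this
  have e : ∀ a b : Fin d, dl a b * dl a b = if a = b then 1 else 0 := by
    intro a b; unfold dl; split_ifs <;> simp
  have e' : ∀ a : Fin d, dl a a = 1 := by intro a; simp [dl]
  simp only [isoState_apply, e, e', Finset.sum_add_distrib, ← Finset.mul_sum]
  simp
  field_simp
  ring

lemma lambda_trace (d : ℕ) (hd : 2 ≤ d) (p : ℝ) : (lambdaNet d p p).trace = 1 := by
  have h := isoState_trace d hd p
  have : (lambdaNet d p p).trace =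
      (∑ a, ∑ b, isoState d p (a, b) (a, b)) * (∑ a, ∑ b, isoState d p (a, b) (a, b)) := by
    simp only [Matrix.trace, Matrix.diag_apply, lambdaNet, Matrix.of_apply,
      Fintype.sum_prod_type, Finset.sum_mul_sum]
  rw [this, h, one_mul]

lemma scalar_bound (d : ℕ) (hd : 2 ≤ d) (p : ℝ) (hp0 : 0 ≤ p) (hp1 : p ≤ 1)
    (hp : p ≤ ((1 + Real.sqrt 2) * d - 1) / ((d : ℝ) ^ 2 + 2 * d - 1)) :
    (p / d) ^ 2 ≤ 2 * ((p / d) * ((1 - p) / (d ^ 2 : ℝ))) + ((1 - p) / (d ^ 2 : ℝ)) ^ 2 := by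
  have hd2 : (2 : ℝ) ≤ d := by exact_mod_cast hd
  have h2 : Real.sqrt 2 * Real.sqrt 2 = 2 := Real.mul_self_sqrt (by norm_num)
  have hs1 : 1 < Real.sqrt 2 := by
    rw [Real.lt_sqrt] <;> norm_num
  have hs2 : Real.sqrt 2 < 2 := by nlinarith
  set s := Real.sqrt 2
  have hD : (d : ℝ) ^ 2 + 2 * d - 1 = (d + 1 - s) * (d + 1 + s) := by nlinarith
  have hN : (1 + s) * d - 1 = (d + 1 - s) * (1 + s) := by nlinarith
  have hpos : (0 : ℝ) < d + 1 - s := by linarith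
  rw [hD, hN, mul_div_mul_left _ _ hpos.ne', le_div_iff₀ (by linarith)] at hp
  have h3 : p * d ≤ (1 + s) * (1 - p) := by linarith
  have h4 : 0 ≤ ((1 + s) * (1 - p) - p * d) * (p * d + (s - 1) * (1 - p)) := by
    apply mul_nonneg (by linarith)
    have : 0 ≤ p * d := by positivity
    have : 0 ≤ (s - 1) * (1 - p) := mul_nonneg (by linarith) (by linarith)
    linarith
  have h5 : (p * d) ^ 2 ≤ 2 * (p * d) * (1 - p) + (1 - p) ^ 2 := by nlinarith
  have hd0 : (0 : ℝ) < d := by linarith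
  have e1 : (p / d) ^ 2 = (p * d) ^ 2 / (d : ℝ) ^ 4 := by field_simp
  have e2 : 2 * ((p / d) * ((1 - p) / (d ^ 2 : ℝ))) + ((1 - p) / (d ^ 2 : ℝ)) ^ 2 =
    (2 * (p * d) * (1 - p) + (1 - p) ^ 2) / (d : ℝ) ^ 4 := by field_simp
  rw [e1, e2]
  gcongr

/-- **Biseparability of the Lambda network of isotropic states.** If
`p ≤ ((1+√2)d − 1)/(d² + 2d − 1)`, the Lambda network of `d`-dimensional isotropic
states with visibility `p`, viewed as a tripartite state of `A = (A₁, A₂)`, `B`, `C`,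
is biseparable. -/
theorem lambda_network_biseparable (d : ℕ) (hd : 2 ≤ d) (p : ℝ)
    (hp0 : 0 ≤ p) (hp1 : p ≤ 1)
    (hp : p ≤ ((1 + Real.sqrt 2) * d - 1) / ((d : ℝ) ^ 2 + 2 * d - 1)) :
    Bisep3 (lambdaNet d p p) := by
  set a : ℝ := p / d with ha
  set b : ℝ := (1 - p) / (d ^ 2 : ℝ) with hb
  have ha0 : 0 ≤ a := by positivity
  have hb0 : 0 ≤ b := div_nonneg (by linarith) (by positivity)
  have hab : a ^ 2 ≤ 2 * (a * b) + b ^ 2 := scalar_bound d hd p hp0 hp1 hp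
  obtain ⟨c, hc0, hc1, hc⟩ : ∃ c : ℝ, 0 ≤ c ∧ c ≤ 1 ∧ a ^ 2 = c * (2 * (a * b) + b ^ 2) := by
    have hS : 0 ≤ 2 * (a * b) + b ^ 2 := by positivity
    rcases hS.eq_or_lt with h | h
    · refine ⟨0, le_rfl, zero_le_one, ?_⟩
      have : 0 ≤ a ^ 2 := by positivity
      linarith
    · exact ⟨a ^ 2 / (2 * (a * b) + b ^ 2), by positivity, (div_le_one h).2 hab,
        (div_mul_cancel₀ _ h.ne').symm⟩
  refine bisep_of_bcone ?_ (lambda_trace d hd p)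
  have hcC : (a : ℂ) ^ 2 = c * (2 * (a * b) + b ^ 2) := by exact_mod_cast hc
  have hc1' : 0 ≤ 1 - c := by linarith
  have key : lambdaNet d p p =
      ((c * b ^ 2 : ℝ) : ℂ) • (Matrix.of fun x y => E1 x y * E2 x y + I1 x y * I2 x y : NetMat d) +
      ((c * (a * b) : ℝ) : ℂ) • (Matrix.of fun x y => (E1 x y + I1 x y) * E2 x y : NetMat d) +
      ((c * (a * b) : ℝ) : ℂ) • (Matrix.of fun x y => (E2 x y + I2 x y) * E1 x y : NetMat d) +
      (((1 - c) * b ^ 2 : ℝ) : ℂ) • (Matrix.of fun x y => I1 x y * I2 x y : NetMat d) +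
      (((1 - c) * (a * b) : ℝ) : ℂ) • (Matrix.of fun x y => I1 x y * E2 x y : NetMat d) +
      (((1 - c) * (a * b) : ℝ) : ℂ) • (Matrix.of fun x y => I2 x y * E1 x y : NetMat d) := by
    ext x y
    simp only [lambdaNet, Matrix.of_apply, Matrix.add_apply, Matrix.smul_apply, smul_eq_mul,
      isoState_apply]
    rw [← ha, ← hb]
    push_cast
    change ((a : ℂ) * E1 x y + b * I1 x y) * (a * E2 x y + b * I2 x y) = _
    linear_combination (E1 x y * E2 x y) * hcC
  rw [key]
  refine add_mem (add_mem (add_mem (add_mem (add_mem ?_ ?_) ?_) ?_) ?_) ?_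
  · exact bcone_smul (gen_A d) _ (by positivity)
  · exact bcone_smul (gen_B d) _ (by positivity)
  · exact bcone_smul (gen_C d) _ (by positivity)
  · exact bcone_smul (gen_II d) _ (by positivity)
  · exact bcone_smul (gen_IE d) _ (by positivity)
  · exact bcone_smul (gen_EI d) _ (by positivity)
end
end
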